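/- arXiv:1411.6283 — 4 statements merged into one kernel-verified Lean document; each statement's English description precedes it below -/
import Mathlib

section
/- Let n ≥ 6 and 3 ≤ K ≤ n−3, and let a, b, c, d be pairwise distinct vertices of V with b ∈ {4,…,n} and c ∈ {4,…,n}. The paw inequality x_{a,b} + x_{b,c} − x_{a,c} + x_{c,d} + x_b + x_c ≤ 2 is facet-defining for P_{n,K} if and only if d < b < c and a < b. -/
/-- A `K`-partition of `V = {1,…,n}`: a family of `K` nonempty pairwise disjoint
subsets of `V` (clusters) whose union is `V`. -/
structure KPartition (n K : ℕ) where
  parts : Finset (Finset ℕ)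
  card_parts : parts.card = K
  parts_nonempty : ∀ C ∈ parts, C.Nonempty
  parts_disjoint : ∀ C ∈ parts, ∀ D ∈ parts, C ≠ D → Disjoint C D
  parts_cover : parts.sup id = Finset.Icc 1 n

/-- The ambient space: one (symmetric) edge coordinate for each pair of vertices and one
representative coordinate for each vertex (only the coordinates of edges `uv ∈ E` and of
vertices `v ∈ {4,…,n}` are actually used; the remaining ones are affinely determined, so
affine dimensions agree with those in `ℝ^{|E|+n-3}`). -/
abbrev GPoint : Type := (ℕ × ℕ → ℝ) × (ℕ → ℝ)

open Classical in
/-- The characteristic vector of a `K`-partition: edge component `x_{u,v} = 1` iff `u` and `v`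
lie in the same cluster; representative component `x_v = 1` (for `v ∈ {4,…,n}`) iff `v` is the
smallest element of its cluster. -/
noncomputable def charVec (n K : ℕ) (π : KPartition n K) : GPoint :=
  ⟨fun p => if ∃ C ∈ π.parts, p.1 ∈ C ∧ p.2 ∈ C then 1 else 0,
   fun v => if 4 ≤ v ∧ ∃ C ∈ π.parts, v ∈ C ∧ ∀ w ∈ C, v ≤ w then 1 else 0⟩

/-- `P_{n,K}`: the convex hull of the characteristic vectors of all `K`-partitions. -/
noncomputable def PolyP (n K : ℕ) : Set GPoint :=
  convexHull ℝ {x | ∃ π : KPartition n K, x = charVec n K π}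

/-- Affine dimension of a set: the rank of the direction of its affine span. -/
noncomputable def adim (s : Set GPoint) : ℕ :=
  Module.finrank ℝ (affineSpan ℝ s).direction

/-- `f x ≤ b` is a valid inequality for `P_{n,K}` which is facet-defining. -/
def IsFacetLe (n K : ℕ) (f : GPoint → ℝ) (b : ℝ) : Prop :=
  (∀ x ∈ PolyP n K, f x ≤ b) ∧
  adim {x | x ∈ PolyP n K ∧ f x = b} + 1 = adim (PolyP n K)

/-- `f x ≥ b` is a valid inequality for `P_{n,K}` which is facet-defining. -/
def IsFacetGe (n K : ℕ) (f : GPoint → ℝ) (b : ℝ) : Prop :=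
  (∀ x ∈ PolyP n K, b ≤ f x) ∧
  adim {x | x ∈ PolyP n K ∧ f x = b} + 1 = adim (PolyP n K)

/-- Sum of the edge components of `x` over the edges with both endpoints in `A`. -/
noncomputable def edgeSum (A : Finset ℕ) (x : GPoint) : ℝ :=
  ∑ e ∈ A.offDiag.filter (fun e => e.1 < e.2), x.1 e

/-- The contribution of a single cluster to the characteristic vector of a partition. -/
noncomputable def clusterVec (C : Finset ℕ) : GPoint :=
  ⟨fun p => if p.1 ∈ C ∧ p.2 ∈ C then 1 else 0,
   fun v => if 4 ≤ v ∧ v ∈ C ∧ ∀ w ∈ C, v ≤ w then 1 else 0⟩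

namespace KPartition

variable {n K : ℕ}

theorem eq_of_mem (π : KPartition n K) {C D : Finset ℕ} (hC : C ∈ π.parts) (hD : D ∈ π.parts)
    {u : ℕ} (huC : u ∈ C) (huD : u ∈ D) : C = D := by
  by_contra h
  exact Finset.disjoint_left.mp (π.parts_disjoint C hC D hD h) huC huD

theorem exists_mem (π : KPartition n K) {u : ℕ} (hu : u ∈ Finset.Icc 1 n) :
    ∃ C ∈ π.parts, u ∈ C := by
  rw [← π.parts_cover] at hu
  simpa [Finset.mem_sup] using hu

theorem subset_Icc (π : KPartition n K) {C : Finset ℕ} (hC : C ∈ π.parts) :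
    C ⊆ Finset.Icc 1 n := by
  rw [← π.parts_cover]
  exact Finset.le_sup (f := id) hC

end KPartition

theorem charVec_edge {n K : ℕ} (π : KPartition n K) {C : Finset ℕ} (hC : C ∈ π.parts) {u : ℕ}
    (hu : u ∈ C) (v : ℕ) : (charVec n K π).1 (u, v) = if v ∈ C then 1 else 0 := by
  have h : (∃ D ∈ π.parts, u ∈ D ∧ v ∈ D) ↔ v ∈ C := by
    constructor
    · rintro ⟨D, hD, huD, hvD⟩
      rwa [π.eq_of_mem hC hD hu huD]
    · exact fun hv => ⟨C, hC, hu, hv⟩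
  simp only [charVec]
  exact if_congr h rfl rfl

theorem charVec_edge' {n K : ℕ} (π : KPartition n K) {C : Finset ℕ} (hC : C ∈ π.parts) {u : ℕ}
    (hu : u ∈ C) (v : ℕ) : (charVec n K π).1 (v, u) = if v ∈ C then 1 else 0 := by
  rw [← charVec_edge π hC hu v]
  simp only [charVec]
  exact if_congr (by simp only [and_comm]) rfl rfl

theorem charVec_rep {n K : ℕ} (π : KPartition n K) {C : Finset ℕ} (hC : C ∈ π.parts) {u : ℕ}
    (hu : u ∈ C) :
    (charVec n K π).2 u = if 4 ≤ u ∧ ∀ w ∈ C, u ≤ w then 1 else 0 := by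
  have h : (∃ D ∈ π.parts, u ∈ D ∧ ∀ w ∈ D, u ≤ w) ↔ ∀ w ∈ C, u ≤ w := by
    constructor
    · rintro ⟨D, hD, huD, hvD⟩
      rwa [π.eq_of_mem hC hD hu huD]
    · exact fun hv => ⟨C, hC, hu, hv⟩
  simp only [charVec, h]

theorem charVec_eq_sum {n K : ℕ} (π : KPartition n K) :
    charVec n K π = ∑ C ∈ π.parts, clusterVec C := by
  ext p
  · rw [Prod.fst_sum, Finset.sum_apply]
    by_cases h : ∃ C ∈ π.parts, p.1 ∈ C
    · obtain ⟨C, hC, hp⟩ := h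
      rw [charVec_edge π hC hp, Finset.sum_eq_single_of_mem C hC]
      · simp [clusterVec, hp]
      · intro D hD hDC
        have : p.1 ∉ D := fun h => hDC (π.eq_of_mem hD hC h hp)
        simp [clusterVec, this]
    · rw [Finset.sum_eq_zero]
      · simp only [charVec]
        rw [if_neg]
        rintro ⟨C, hC, hp, -⟩
        exact h ⟨C, hC, hp⟩
      · intro D hD
        have : p.1 ∉ D := fun hp => h ⟨D, hD, hp⟩
        simp [clusterVec, this]
  · rw [Prod.snd_sum, Finset.sum_apply]
    by_cases h : ∃ C ∈ π.parts, p ∈ C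
    · obtain ⟨C, hC, hp⟩ := h
      rw [charVec_rep π hC hp, Finset.sum_eq_single_of_mem C hC]
      · simp [clusterVec, hp]
      · intro D hD hDC
        have : p ∉ D := fun h => hDC (π.eq_of_mem hD hC h hp)
        simp [clusterVec, this]
    · rw [Finset.sum_eq_zero]
      · simp only [charVec]
        rw [if_neg]
        rintro ⟨-, C, hC, hp, -⟩
        exact h ⟨C, hC, hp⟩
      · intro D hD
        have : p ∉ D := fun hp => h ⟨D, hD, hp⟩
        simp [clusterVec, this]

/-- Any `U` that is not too large can be split off: the remaining vertices admit a fixed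
partition into `K - 2` clusters, one of which contains `C`, with the elements of `S` isolated. -/
theorem exists_filling {n K : ℕ} (hK : 3 ≤ K) (U C S : Finset ℕ) (hU : U ⊆ Finset.Icc 1 n)
    (hC : C ⊆ Finset.Icc 1 n) (hS : S ⊆ Finset.Icc 1 n) (hUC : Disjoint U C)
    (hUS : Disjoint U S) (hCS : Disjoint C S) (hcard : U.card + K ≤ n + 2)
    (hcard' : U.card + C.card + K ≤ n + 3) (hSK : S.card + 3 ≤ K) :
    ∃ T : Finset (Finset ℕ), (∃ D ∈ T, C ⊆ D) ∧ (∀ s ∈ S, {s} ∈ T) ∧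
      ∀ A B : Finset ℕ, A.Nonempty → B.Nonempty → Disjoint A B → A ∪ B = U →
        A ∉ insert B T ∧ B ∉ T ∧ ∃ π : KPartition n K, π.parts = insert A (insert B T) := by
  have hsub : S ⊆ (Finset.Icc 1 n \ U) \ C := by
    intro s hs
    simp only [Finset.mem_sdiff]
    exact ⟨⟨hS hs, fun h => Finset.disjoint_left.mp hUS h hs⟩,
      fun h => Finset.disjoint_left.mp hCS h hs⟩
  have hcW : (Finset.Icc 1 n \ U).card = n - U.card := by
    rw [Finset.card_sdiff_of_subset hU]; simp
  have hCW : C ⊆ Finset.Icc 1 n \ U := fun x hx =>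
    Finset.mem_sdiff.mpr ⟨hC hx, fun h => Finset.disjoint_left.mp hUC h hx⟩
  have hcWC : ((Finset.Icc 1 n \ U) \ C).card = n - U.card - C.card := by
    rw [Finset.card_sdiff_of_subset hCW, hcW]
  obtain ⟨S', hSS', hS', hcS'⟩ := Finset.exists_subsuperset_card_eq (n := K - 3) hsub
    (by omega) (by omega)
  set D := (Finset.Icc 1 n \ U) \ S' with hD
  have hS'W : S' ⊆ Finset.Icc 1 n \ U := hS'.trans Finset.sdiff_subset
  have hDne : D.Nonempty := by
    rw [← Finset.card_pos, hD, Finset.card_sdiff_of_subset hS'W]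
    omega
  have hDS : Disjoint D S' := Finset.sdiff_disjoint
  have hDmem : D ∉ S'.image (fun s => ({s} : Finset ℕ)) := by
    intro h
    obtain ⟨s, hs, hsD⟩ := Finset.mem_image.mp h
    exact Finset.disjoint_left.mp hDS (hsD ▸ Finset.mem_singleton_self s) hs
  set T := insert D (S'.image (fun s => ({s} : Finset ℕ))) with hT
  have hTcard : T.card = K - 2 := by
    rw [hT, Finset.card_insert_of_notMem hDmem,
      Finset.card_image_of_injective _ Finset.singleton_injective, hcS']
    omega
  have hTne : ∀ X ∈ T, X.Nonempty := by
    intro X hX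
    rcases Finset.mem_insert.mp hX with rfl | hX
    · exact hDne
    · obtain ⟨s, -, rfl⟩ := Finset.mem_image.mp hX
      exact Finset.singleton_nonempty s
  have hTU : ∀ X ∈ T, Disjoint X U := by
    intro X hX
    rcases Finset.mem_insert.mp hX with rfl | hX
    · exact Finset.disjoint_of_subset_left Finset.sdiff_subset Finset.sdiff_disjoint
    · obtain ⟨s, hs, rfl⟩ := Finset.mem_image.mp hX
      exact Finset.disjoint_singleton_left.mpr (Finset.mem_sdiff.mp (hS'W hs)).2
  have hTd : ∀ X ∈ T, ∀ Y ∈ T, X ≠ Y → Disjoint X Y := by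
    intro X hX Y hY hXY
    rcases Finset.mem_insert.mp hX with rfl | hX
    · rcases Finset.mem_insert.mp hY with rfl | hY
      · exact absurd rfl hXY
      · obtain ⟨s, hs, rfl⟩ := Finset.mem_image.mp hY
        exact Finset.disjoint_singleton_right.mpr fun h => Finset.disjoint_left.mp hDS h hs
    · obtain ⟨s, hs, rfl⟩ := Finset.mem_image.mp hX
      rcases Finset.mem_insert.mp hY with rfl | hY
      · exact Finset.disjoint_singleton_left.mpr fun h => Finset.disjoint_left.mp hDS h hs
      · obtain ⟨t, ht, rfl⟩ := Finset.mem_image.mp hY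
        exact Finset.disjoint_singleton.mpr fun h => hXY (by rw [h])
  have hTsup : T.sup id = Finset.Icc 1 n \ U := by
    rw [hT, Finset.sup_insert, Finset.sup_image]
    ext x
    simp only [id, Finset.sup_eq_union, Finset.mem_union, Finset.mem_sup, Function.comp,
      Finset.mem_singleton, exists_eq_right', hD]
    have := @hS'W x
    rw [Finset.mem_sdiff (s := Finset.Icc 1 n \ U)]
    tauto
  refine ⟨T, ⟨D, Finset.mem_insert_self _ _, fun x hx => Finset.mem_sdiff.mpr ⟨hCW hx, fun h =>
    (Finset.mem_sdiff.mp (hS' h)).2 hx⟩⟩, fun s hs => Finset.mem_insert_of_mem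
    (Finset.mem_image_of_mem _ (hSS' hs)), ?_⟩
  intro A B hA hB hAB hABU
  have hAT : ∀ X ∈ T, Disjoint A X := fun X hX =>
    (Finset.disjoint_of_subset_right (hABU ▸ Finset.subset_union_left) (hTU X hX)).symm
  have hBT : ∀ X ∈ T, Disjoint B X := fun X hX =>
    (Finset.disjoint_of_subset_right (hABU ▸ Finset.subset_union_right) (hTU X hX)).symm
  have hBn : B ∉ T := fun h => hB.ne_empty (Finset.disjoint_self_iff_empty B |>.mp (hBT B h))
  have hAn : A ∉ insert B T := by
    intro h
    rcases Finset.mem_insert.mp h with rfl | h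
    · exact hA.ne_empty (Finset.disjoint_self_iff_empty A |>.mp hAB)
    · exact hA.ne_empty (Finset.disjoint_self_iff_empty A |>.mp (hAT A h))
  refine ⟨hAn, hBn, ⟨insert A (insert B T), ?_, ?_, ?_, ?_⟩, rfl⟩
  · rw [Finset.card_insert_of_notMem hAn, Finset.card_insert_of_notMem hBn, hTcard]
    omega
  · simpa only [Finset.forall_mem_insert] using ⟨hA, hB, hTne⟩
  · simp only [Finset.forall_mem_insert]
    exact ⟨⟨fun h => absurd rfl h, fun _ => hAB, fun X hX _ => hAT X hX⟩,
      ⟨fun _ => hAB.symm, fun h => absurd rfl h, fun X hX _ => hBT X hX⟩,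
      fun X hX => ⟨fun _ => (hAT X hX).symm, fun _ => (hBT X hX).symm, hTd X hX⟩⟩
  · rw [Finset.sup_insert, Finset.sup_insert, hTsup, ← hABU]
    rw [← hABU] at hU
    simp only [id, Finset.sup_eq_union, ← Finset.union_assoc]
    exact Finset.union_sdiff_of_subset hU

/-- The value of a functional on a cluster, normalised to vanish on singletons. -/
noncomputable def excess (φ : GPoint →ₗ[ℝ] ℝ) (S : Finset ℕ) : ℝ :=
  φ (clusterVec S) - ∑ x ∈ S, φ (clusterVec {x})

theorem map_charVec {n K : ℕ} (φ : GPoint →ₗ[ℝ] ℝ) (π : KPartition n K) :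
    φ (charVec n K π) =
      ∑ C ∈ π.parts, excess φ C + ∑ x ∈ Finset.Icc 1 n, φ (clusterVec {x}) := by
  have h : ∑ x ∈ Finset.Icc 1 n, φ (clusterVec {x}) =
      ∑ C ∈ π.parts, ∑ x ∈ C, φ (clusterVec {x}) := by
    rw [← π.parts_cover, Finset.sup_eq_biUnion, Finset.sum_biUnion]
    · rfl
    · exact fun C hC D hD hCD => π.parts_disjoint C hC D hD hCD
  rw [h, ← Finset.sum_add_distrib, charVec_eq_sum, map_sum]
  simp [excess]

/-- Redistributing the vertices of two clusters does not change the total excess of a functional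
which is constant on the partitions satisfying `P`. -/
theorem excess_exchange {n K : ℕ} (hK : 3 ≤ K) {P : KPartition n K → Prop}
    {φ : GPoint →ₗ[ℝ] ℝ}
    (hφ : ∀ π π', P π → P π' → φ (charVec n K π) = φ (charVec n K π'))
    (C S A B A' B' : Finset ℕ) (hA : A.Nonempty) (hB : B.Nonempty) (hA' : A'.Nonempty)
    (hB' : B'.Nonempty) (hAB : Disjoint A B) (hAB' : Disjoint A' B') (hU : A' ∪ B' = A ∪ B)
    (hUn : A ∪ B ⊆ Finset.Icc 1 n)
    (hC : C ⊆ Finset.Icc 1 n) (hS : S ⊆ Finset.Icc 1 n) (hUC : Disjoint (A ∪ B) C)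
    (hUS : Disjoint (A ∪ B) S) (hCS : Disjoint C S) (hcard : (A ∪ B).card + K ≤ n + 2)
    (hcard' : (A ∪ B).card + C.card + K ≤ n + 3) (hSK : S.card + 3 ≤ K)
    (hP : ∀ π : KPartition n K, A ∈ π.parts → B ∈ π.parts → (∃ D ∈ π.parts, C ⊆ D) →
      (∀ s ∈ S, {s} ∈ π.parts) → P π)
    (hP' : ∀ π : KPartition n K, A' ∈ π.parts → B' ∈ π.parts → (∃ D ∈ π.parts, C ⊆ D) →
      (∀ s ∈ S, {s} ∈ π.parts) → P π) :
    excess φ A + excess φ B = excess φ A' + excess φ B' := by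
  obtain ⟨T, ⟨D, hD, hCD⟩, hT, h⟩ :=
    exists_filling hK (A ∪ B) C S hUn hC hS hUC hUS hCS hcard hcard' hSK
  obtain ⟨h1, h2, π, hπ⟩ := h A B hA hB hAB rfl
  obtain ⟨h1', h2', π', hπ'⟩ := h A' B' hA' hB' hAB' hU
  have e := hφ π π'
    (hP π (by simp [hπ]) (by simp [hπ]) ⟨D, by simp [hπ, hD], hCD⟩
      (fun s hs => by simp [hπ, hT s hs]))
    (hP' π' (by simp [hπ']) (by simp [hπ']) ⟨D, by simp [hπ', hD], hCD⟩
      (fun s hs => by simp [hπ', hT s hs]))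
  rw [map_charVec, map_charVec, hπ, hπ', Finset.sum_insert h1, Finset.sum_insert h2,
    Finset.sum_insert h1', Finset.sum_insert h2'] at e
  linarith

/-- The symmetric edge coefficient of a functional. -/
noncomputable def edgeCoeff (φ : GPoint →ₗ[ℝ] ℝ) (u v : ℕ) : ℝ :=
  φ (Pi.single (u, v) 1, 0) + φ (Pi.single (v, u) 1, 0)

/-- The representative coefficient of a functional. -/
noncomputable def repCoeff (φ : GPoint →ₗ[ℝ] ℝ) (v : ℕ) : ℝ :=
  if 4 ≤ v then φ (0, Pi.single v 1) else 0

theorem repCoeff_of_lt_four (φ : GPoint →ₗ[ℝ] ℝ) {x : ℕ} (hx : x < 4) : repCoeff φ x = 0 :=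
  if_neg (by omega)

theorem clusterVec_eq {S : Finset ℕ} {m : ℕ} (hm : m ∈ S) (hmin : ∀ w ∈ S, m ≤ w) :
    clusterVec S = ∑ u ∈ S, ∑ v ∈ S, ((Pi.single (u, v) 1, 0) : GPoint) +
      if 4 ≤ m then (0, Pi.single m 1) else 0 := by
  rw [← Finset.sum_product' S S (fun u v => ((Pi.single (u, v) 1, 0) : GPoint))]
  ext p
  · have : (if 4 ≤ m then ((0, Pi.single m 1) : GPoint) else 0).1 = 0 := by split_ifs <;> rfl
    rw [Prod.fst_add, this, Prod.fst_sum, add_zero, Finset.sum_apply]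
    simp [clusterVec, Pi.single_apply]
  · have hu : ∀ v, (v ∈ S ∧ ∀ w ∈ S, v ≤ w) ↔ v = m := fun v =>
      ⟨fun h => le_antisymm (h.2 m hm) (hmin v h.1), fun h => h ▸ ⟨hm, hmin⟩⟩
    rw [Prod.snd_add, Prod.snd_sum]
    simp only [clusterVec, hu, Finset.sum_const_zero, zero_add]
    by_cases h : 4 ≤ m
    · simp only [h, if_true, Pi.single_apply]
      split_ifs <;> first | rfl | omega
    · simp only [h, if_false]
      rw [if_neg (by omega)]
      rfl

theorem two_mul_map_clusterVec (φ : GPoint →ₗ[ℝ] ℝ) {S : Finset ℕ} {m : ℕ} (hm : m ∈ S)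
    (hmin : ∀ w ∈ S, m ≤ w) :
    2 * φ (clusterVec S) = ∑ u ∈ S, ∑ v ∈ S, edgeCoeff φ u v + 2 * repCoeff φ m := by
  have h : φ (clusterVec S) =
      ∑ u ∈ S, ∑ v ∈ S, φ (Pi.single (u, v) 1, 0) + repCoeff φ m := by
    rw [clusterVec_eq hm hmin, map_add, map_sum, repCoeff, apply_ite φ, map_zero]
    simp only [map_sum]
  have h' := Finset.sum_comm (s := S) (t := S) (f := fun u v => φ (Pi.single (u, v) 1, 0))
  simp only [edgeCoeff, Finset.sum_add_distrib]
  linarith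

theorem edgeCoeff_comm (φ : GPoint →ₗ[ℝ] ℝ) (u v : ℕ) : edgeCoeff φ u v = edgeCoeff φ v u :=
  add_comm _ _

theorem two_mul_excess (φ : GPoint →ₗ[ℝ] ℝ) {S : Finset ℕ} {m : ℕ} (hm : m ∈ S)
    (hmin : ∀ w ∈ S, m ≤ w) :
    2 * excess φ S = ∑ u ∈ S, ∑ v ∈ S, edgeCoeff φ u v + 2 * repCoeff φ m -
      ∑ u ∈ S, (edgeCoeff φ u u + 2 * repCoeff φ u) := by
  have h : ∀ u, edgeCoeff φ u u + 2 * repCoeff φ u = 2 * φ (clusterVec {u}) := by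
    intro u
    rw [two_mul_map_clusterVec φ (Finset.mem_singleton_self u) (by simp)]
    simp
  simp only [h, ← Finset.mul_sum, excess, mul_sub, two_mul_map_clusterVec φ hm hmin]

theorem excess_singleton (φ : GPoint →ₗ[ℝ] ℝ) (u : ℕ) : excess φ {u} = 0 := by
  simp [excess]

theorem excess_pair (φ : GPoint →ₗ[ℝ] ℝ) {u v : ℕ} (huv : u ≠ v) :
    excess φ {u, v} =
      edgeCoeff φ u v + repCoeff φ (min u v) - repCoeff φ u - repCoeff φ v := by
  have h := two_mul_excess φ (S := {u, v}) (m := min u v) (by grind) (by grind)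
  simp only [Finset.sum_insert (Finset.notMem_singleton.mpr huv), Finset.sum_singleton,
    edgeCoeff_comm φ v u] at h
  linarith

theorem excess_triple (φ : GPoint →ₗ[ℝ] ℝ) {u v w : ℕ} (huv : u ≠ v) (huw : u ≠ w)
    (hvw : v ≠ w) :
    excess φ {u, v, w} =
      edgeCoeff φ u v + edgeCoeff φ u w + edgeCoeff φ v w + repCoeff φ (min u (min v w))
        - repCoeff φ u - repCoeff φ v - repCoeff φ w := by
  have h := two_mul_excess φ (S := {u, v, w}) (m := min u (min v w)) (by grind) (by grind)
  have h1 : u ∉ ({v, w} : Finset ℕ) := by simp [*]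
  have h2 : v ∉ ({w} : Finset ℕ) := by simp [*]
  simp only [Finset.sum_insert h1, Finset.sum_insert h2, Finset.sum_singleton,
    edgeCoeff_comm φ v u, edgeCoeff_comm φ w u, edgeCoeff_comm φ w v] at h
  linarith

theorem excess_quadruple (φ : GPoint →ₗ[ℝ] ℝ) {u v w x : ℕ} (huv : u ≠ v) (huw : u ≠ w)
    (hux : u ≠ x) (hvw : v ≠ w) (hvx : v ≠ x) (hwx : w ≠ x) :
    excess φ {u, v, w, x} =
      edgeCoeff φ u v + edgeCoeff φ u w + edgeCoeff φ u x + edgeCoeff φ v w + edgeCoeff φ v x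
        + edgeCoeff φ w x + repCoeff φ (min u (min v (min w x)))
        - repCoeff φ u - repCoeff φ v - repCoeff φ w - repCoeff φ x := by
  have h := two_mul_excess φ (S := {u, v, w, x}) (m := min u (min v (min w x)))
    (by grind) (by grind)
  have h1 : u ∉ ({v, w, x} : Finset ℕ) := by simp [*]
  have h2 : v ∉ ({w, x} : Finset ℕ) := by simp [*]
  have h3 : w ∉ ({x} : Finset ℕ) := by simp [*]
  simp only [Finset.sum_insert h1, Finset.sum_insert h2, Finset.sum_insert h3,
    Finset.sum_singleton, edgeCoeff_comm φ v u, edgeCoeff_comm φ w u, edgeCoeff_comm φ w v,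
    edgeCoeff_comm φ x u, edgeCoeff_comm φ x v, edgeCoeff_comm φ x w] at h
  linarith

/-- A functional whose coefficients vanish is constant on the characteristic vectors. -/
theorem map_charVec_of_coeff_eq_zero {n K : ℕ} (φ : GPoint →ₗ[ℝ] ℝ)
    (hq : ∀ u ∈ Finset.Icc 1 n, ∀ v ∈ Finset.Icc 1 n, u ≠ v → edgeCoeff φ u v = 0)
    (hr : ∀ u ∈ Finset.Icc 1 n, repCoeff φ u = 0) (π : KPartition n K) :
    φ (charVec n K π) = ∑ x ∈ Finset.Icc 1 n, φ (clusterVec {x}) := by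
  rw [map_charVec, Finset.sum_eq_zero, zero_add]
  intro C hC
  have hCn := π.subset_Icc hC
  have h := two_mul_excess φ (C.min'_mem (π.parts_nonempty C hC))
    (fun w hw => C.min'_le w hw)
  rw [hr _ (hCn (C.min'_mem _)), Finset.sum_congr rfl (g := fun u => edgeCoeff φ u u)
    (fun u hu => Finset.sum_eq_single_of_mem u hu fun v hv hvu =>
      hq u (hCn hu) v (hCn hv) hvu.symm),
    Finset.sum_congr rfl (f := fun u => edgeCoeff φ u u + 2 * repCoeff φ u)
    (g := fun u => edgeCoeff φ u u) (fun u hu => by rw [hr u (hCn hu)]; ring)] at h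
  linarith

/-- The left-hand side of the paw inequality. -/
noncomputable def pawMap (a b c d : ℕ) : GPoint →ₗ[ℝ] ℝ where
  toFun x := x.1 (a, b) + x.1 (b, c) - x.1 (a, c) + x.1 (c, d) + x.2 b + x.2 c
  map_add' x y := by simp only [Prod.fst_add, Prod.snd_add, Pi.add_apply]; ring
  map_smul' r x := by
    simp only [Prod.smul_fst, Prod.smul_snd, Pi.smul_apply, smul_eq_mul, RingHom.id_apply]; ring

theorem pawMap_apply (a b c d : ℕ) (x : GPoint) : pawMap a b c d x =
    x.1 (a, b) + x.1 (b, c) - x.1 (a, c) + x.1 (c, d) + x.2 b + x.2 c := rfl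

theorem pawMap_charVec {n K a b c d : ℕ} (hb : 4 ≤ b) (hc : 4 ≤ c) (π : KPartition n K)
    {C D : Finset ℕ} (hC : C ∈ π.parts) (hD : D ∈ π.parts) (hbC : b ∈ C) (hcD : c ∈ D) :
    pawMap a b c d (charVec n K π) =
      (if a ∈ C then 1 else 0) + (if c ∈ C then 1 else 0) - (if a ∈ D then 1 else 0)
        + (if d ∈ D then 1 else 0) + (if ∀ w ∈ C, b ≤ w then 1 else 0)
        + (if ∀ w ∈ D, c ≤ w then 1 else 0) := by
  rw [pawMap_apply, charVec_edge' π hC hbC, charVec_edge π hC hbC, charVec_edge' π hD hcD,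
    charVec_edge π hD hcD, charVec_rep π hC hbC, charVec_rep π hD hcD]
  simp only [hb, hc, true_and]

theorem pawMap_eq_two_of_mem {n K a b c d : ℕ} (hb : 4 ≤ b) (hdb : d < b) (hbc : b < c)
    (π : KPartition n K) {C : Finset ℕ} (hC : C ∈ π.parts) (hbC : b ∈ C) (hcC : c ∈ C)
    (hdC : d ∈ C) : pawMap a b c d (charVec n K π) = 2 := by
  have h1 : ¬∀ w ∈ C, b ≤ w := fun h => absurd (h d hdC) (by omega)
  have h2 : ¬∀ w ∈ C, c ≤ w := fun h => absurd (h d hdC) (by omega)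
  rw [pawMap_charVec hb (by omega) π hC hC hbC hcC, if_pos hcC, if_pos hdC, if_neg h1, if_neg h2]
  ring

theorem pawMap_eq_two_of_pair {n K a b c d : ℕ} (hb : 4 ≤ b) (hab : a < b) (hdb : d < b)
    (hbc : b < c) (π : KPartition n K) (hC : {b, c} ∈ π.parts) :
    pawMap a b c d (charVec n K π) = 2 := by
  have h1 : ∀ w ∈ ({b, c} : Finset ℕ), b ≤ w := by simp [hbc.le]
  have h2 : ¬∀ w ∈ ({b, c} : Finset ℕ), c ≤ w := fun h => absurd (h b (by simp)) (by omega)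
  have h3 : a ∉ ({b, c} : Finset ℕ) := by grind
  have h4 : d ∉ ({b, c} : Finset ℕ) := by grind
  rw [pawMap_charVec hb (by omega) π hC hC (by simp) (by simp), if_neg h3, if_neg h4, if_pos h1,
    if_neg h2, if_pos (by simp)]
  ring

theorem pawMap_eq_two_of_separate {n K a b c d : ℕ} (hb : 4 ≤ b) (hab : a < b) (hdb : d < b)
    (hbc : b < c) (π : KPartition n K) {C D : Finset ℕ} (hC : C ∈ π.parts) (hD : D ∈ π.parts)
    (hbC : b ∈ C) (hcD : c ∈ D) (hcC : c ∉ C) (haC : a ∈ C ∨ C = {b} ∧ a ∉ D)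
    (hdD : d ∈ D ∨ D = {c}) : pawMap a b c d (charVec n K π) = 2 := by
  have haD : a ∉ D := by
    rcases haC with h | h
    · intro h'
      rw [π.eq_of_mem hC hD h h'] at hcC
      exact hcC hcD
    · exact h.2
  have hb' : ((if a ∈ C then 1 else 0) + (if ∀ w ∈ C, b ≤ w then 1 else 0) : ℝ) = 1 := by
    rcases haC with h | ⟨rfl, -⟩
    · have h1 : ¬∀ w ∈ C, b ≤ w := fun h' => absurd (h' a h) (by omega)
      rw [if_pos h, if_neg h1, add_zero]
    · rw [if_neg (by simpa using hab.ne), if_pos (by simp), zero_add]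
  have hc' : ((if d ∈ D then 1 else 0) + (if ∀ w ∈ D, c ≤ w then 1 else 0) : ℝ) = 1 := by
    rcases hdD with h | rfl
    · have h1 : ¬∀ w ∈ D, c ≤ w := fun h' => absurd (h' d h) (by omega)
      rw [if_pos h, if_neg h1, add_zero]
    · rw [if_neg (by simp; omega), if_pos (by simp), zero_add]
  rw [pawMap_charVec hb (by omega) π hC hD hbC hcD, if_neg hcC, if_neg haD]
  linarith

/-- `φ` is constant on the `K`-partitions satisfying the paw inequality with equality, where
`a`, `b`, `c`, `d` are ordered as in the facet case. -/
structure ConstOnPawFace (n K a b c d : ℕ) (φ : GPoint →ₗ[ℝ] ℝ) : Prop where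
  three_le : 3 ≤ K
  add_three_le : K + 3 ≤ n
  one_le_a : 1 ≤ a
  one_le_d : 1 ≤ d
  a_ne_d : a ≠ d
  four_le_b : 4 ≤ b
  a_lt_b : a < b
  d_lt_b : d < b
  b_lt_c : b < c
  c_le : c ≤ n
  const : ∀ π π' : KPartition n K, pawMap a b c d (charVec n K π) = 2 →
    pawMap a b c d (charVec n K π') = 2 → φ (charVec n K π) = φ (charVec n K π')

namespace ConstOnPawFace

variable {n K a b c d : ℕ} {φ : GPoint →ₗ[ℝ] ℝ}

theorem exchange (h : ConstOnPawFace n K a b c d φ) (C A B A' B' : Finset ℕ)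
    (hP : ∀ π : KPartition n K, A ∈ π.parts → B ∈ π.parts → (∃ D ∈ π.parts, C ⊆ D) →
      pawMap a b c d (charVec n K π) = 2)
    (hP' : ∀ π : KPartition n K, A' ∈ π.parts → B' ∈ π.parts → (∃ D ∈ π.parts, C ⊆ D) →
      pawMap a b c d (charVec n K π) = 2)
    (hA : A.Nonempty := by simp) (hB : B.Nonempty := by simp) (hA' : A'.Nonempty := by simp)
    (hB' : B'.Nonempty := by simp)
    (hAB : ∀ x ∈ A, x ∉ B := by
      intro x; simp only [Finset.mem_insert, Finset.mem_singleton]; omega)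
    (hAB' : ∀ x ∈ A', x ∉ B' := by
      intro x; simp only [Finset.mem_insert, Finset.mem_singleton]; omega)
    (hU : A' ∪ B' = A ∪ B := by
      clear * -
      ext x; simp only [Finset.mem_union, Finset.mem_insert, Finset.mem_singleton]; tauto)
    (hsub : A ∪ B ∪ C ⊆ Finset.Icc 1 n := by
      simp only [Finset.union_subset_iff, Finset.insert_subset_iff, Finset.singleton_subset_iff,
        Finset.empty_subset, Finset.mem_Icc, and_true]
      omega)
    (hUC : ∀ x ∈ A ∪ B, x ∉ C := by
      intro x
      simp only [Finset.mem_union, Finset.mem_insert, Finset.mem_singleton, Finset.notMem_empty,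
        not_false_eq_true, implies_true] <;> omega)
    (hcard : A.card + B.card ≤ 5 := by clear * -; grind)
    (hcard' : A.card + B.card + C.card + K ≤ n + 3 := by
      refine (Nat.add_le_add_right (m := 6) (by clear * -; grind) K).trans (by omega)) :
    excess φ A + excess φ B = excess φ A' + excess φ B' := by
  have := Finset.card_union_le A B
  have := h.add_three_le
  exact excess_exchange h.three_le h.const C ∅ A B A' B' hA hB hA' hB'
    (Finset.disjoint_left.mpr hAB)
    (Finset.disjoint_left.mpr hAB') hU (Finset.union_subset_left hsub)
    (Finset.union_subset_right hsub) (by simp) (Finset.disjoint_left.mpr hUC) (by simp)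
    (by simp) (by omega) (by omega) (by simpa using h.three_le)
    (fun π h1 h2 h3 _ => hP π h1 h2 h3) (fun π h1 h2 h3 _ => hP' π h1 h2 h3)

theorem tight_of_mem (h : ConstOnPawFace n K a b c d φ) (π : KPartition n K) {C : Finset ℕ}
    (hC : C ∈ π.parts) (hbC : b ∈ C := by simp) (hcC : c ∈ C := by simp)
    (hdC : d ∈ C := by simp) : pawMap a b c d (charVec n K π) = 2 :=
  pawMap_eq_two_of_mem h.four_le_b h.d_lt_b h.b_lt_c π hC hbC hcC hdC

theorem tight_of_pair (h : ConstOnPawFace n K a b c d φ) (π : KPartition n K)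
    (hC : {b, c} ∈ π.parts) : pawMap a b c d (charVec n K π) = 2 :=
  pawMap_eq_two_of_pair h.four_le_b h.a_lt_b h.d_lt_b h.b_lt_c π hC

theorem tight_of_separate (h : ConstOnPawFace n K a b c d φ) (π : KPartition n K)
    {C D : Finset ℕ} (hC : C ∈ π.parts) (hD : D ∈ π.parts) (haC : a ∈ C := by simp)
    (hdD : d ∈ D ∨ D = {c} := by simp) (hbC : b ∈ C := by simp) (hcD : c ∈ D := by simp)
    (hcC : c ∉ C := by simp only [Finset.mem_insert, Finset.mem_singleton]; omega) :
    pawMap a b c d (charVec n K π) = 2 :=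
  pawMap_eq_two_of_separate h.four_le_b h.a_lt_b h.d_lt_b h.b_lt_c π hC hD hbC hcD hcC
    (Or.inl haC) hdD

theorem tight_of_singleton (h : ConstOnPawFace n K a b c d φ) (π : KPartition n K)
    {D : Finset ℕ} (hC : {b} ∈ π.parts) (hD : D ∈ π.parts)
    (haD : a ∉ D := by simp only [Finset.mem_insert, Finset.mem_singleton]; omega)
    (hdD : d ∈ D := by simp) (hcD : c ∈ D := by simp) :
    pawMap a b c d (charVec n K π) = 2 :=
  pawMap_eq_two_of_separate h.four_le_b h.a_lt_b h.d_lt_b h.b_lt_c π hC hD (by simp) hcD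
    (by simpa using h.b_lt_c.ne') (Or.inr ⟨rfl, haD⟩) (Or.inl hdD)

theorem excess_paw (h : ConstOnPawFace n K a b c d φ) :
    excess φ {b, c} = excess φ {a, b} ∧ excess φ {c, d} = excess φ {a, b} ∧
      excess φ {a, d} = excess φ {a, b} ∧ excess φ {b, c, d} = 2 * excess φ {a, b} ∧
      excess φ {a, b, d} = 2 * excess φ {a, b} := by
  obtain ⟨hK1, hK2, ha, hd, had, hb, hab, hdb, hbc, hcn, -⟩ := id h
  have e1 : excess φ {b, c} + excess φ {d} = excess φ {b} + excess φ {c, d} :=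
    h.exchange {a} _ _ _ _ (fun π h1 _ _ => h.tight_of_pair π h1)
      (fun π h1 h2 _ => h.tight_of_singleton π h1 h2)
  have e2 : excess φ {a, b} + excess φ {c} = excess φ {a} + excess φ {b, c} :=
    h.exchange {d} _ _ _ _ (fun π h1 h2 _ => h.tight_of_separate π h1 h2)
      (fun π _ h2 _ => h.tight_of_pair π h2)
  have e3 : excess φ {b, c, d} + excess φ {a} = excess φ {b, c} + excess φ {a, d} :=
    h.exchange ∅ _ _ _ _ (fun π h1 _ _ => h.tight_of_mem π h1)
      (fun π h1 _ _ => h.tight_of_pair π h1)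
  have e4 : excess φ {c, d} + excess φ {a, b} = excess φ {b, c} + excess φ {a, d} :=
    h.exchange ∅ _ _ _ _ (fun π h1 h2 _ => h.tight_of_separate π h2 h1)
      (fun π h1 _ _ => h.tight_of_pair π h1)
  have e5 : excess φ {c} + excess φ {a, b, d} = excess φ {b, c} + excess φ {a, d} :=
    h.exchange ∅ _ _ _ _ (fun π h1 h2 _ => h.tight_of_separate π h2 h1)
      (fun π h1 _ _ => h.tight_of_pair π h1)
  simp only [excess_singleton] at e1 e2 e3 e5
  refine ⟨?_, ?_, ?_, ?_, ?_⟩ <;> linarith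

theorem excess_one (h : ConstOnPawFace n K a b c d φ) {u : ℕ}
    (hu : u ∈ Finset.Icc 1 n \ {a, b, c, d}) :
    excess φ {a, u} = excess φ {a, b} ∧ excess φ {d, u} = excess φ {a, b} ∧
      excess φ {c, d, u} = 2 * excess φ {a, b} ∧ excess φ {a, d, u} = 2 * excess φ {a, b} ∧
      excess φ {b, c, d, a} = 3 * excess φ {a, b} ∧
      excess φ {b, c, d, u} = 3 * excess φ {a, b} := by
  obtain ⟨hK1, hK2, ha, hd, had, hb, hab, hdb, hbc, hcn, -⟩ := id h
  simp only [Finset.mem_sdiff, Finset.mem_insert, Finset.mem_singleton, not_or,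
    Finset.mem_Icc] at hu
  obtain ⟨⟨hu1, hun⟩, hua, hub, huc, hud⟩ := hu
  have f1 : excess φ {a, b} + excess φ {u} = excess φ {b} + excess φ {a, u} :=
    h.exchange {c, d} _ _ _ _
      (fun π h1 _ ⟨D, hD, hs⟩ => h.tight_of_separate π h1 hD (by simp) (Or.inl (hs (by simp)))
        (by simp) (hs (by simp)))
      (fun π h1 h2 ⟨D, hD, hs⟩ => h.tight_of_singleton π h1 hD
        (fun h' => by
          have := π.eq_of_mem h2 hD (u := a) (by simp) h' ▸ hs (show c ∈ {c, d} by simp)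
          simp only [Finset.mem_insert, Finset.mem_singleton] at this
          omega)
        (hs (by simp)) (hs (by simp)))
  have f2 : excess φ {c, d} + excess φ {u} = excess φ {c} + excess φ {d, u} :=
    h.exchange {a, b} _ _ _ _
      (fun π h1 _ ⟨D, hD, hs⟩ => h.tight_of_separate π hD h1 (hs (by simp)) (by simp)
        (hs (by simp)) (by simp) (fun h' => by
          have := π.eq_of_mem h1 hD (u := c) (by simp) h' ▸ hs (show b ∈ {a, b} by simp)
          simp only [Finset.mem_insert, Finset.mem_singleton] at this
          omega))
      (fun π h1 _ ⟨D, hD, hs⟩ => h.tight_of_separate π hD h1 (hs (by simp)) (by simp)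
        (hs (by simp)) (by simp) (fun h' => by
          have := π.eq_of_mem h1 hD (u := c) (by simp) h' ▸ hs (show b ∈ {a, b} by simp)
          simp only [Finset.mem_singleton] at this
          omega))
  have f3 : excess φ {b, c, d} + excess φ {u} = excess φ {b, c} + excess φ {d, u} :=
    h.exchange ∅ _ _ _ _ (fun π h1 _ _ => h.tight_of_mem π h1)
      (fun π h1 _ _ => h.tight_of_pair π h1)
  have f4 : excess φ {b, c, d} + excess φ {u} = excess φ {b} + excess φ {c, d, u} :=
    h.exchange ∅ _ _ _ _ (fun π h1 _ _ => h.tight_of_mem π h1)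
      (fun π h1 h2 _ => h.tight_of_singleton π h1 h2)
  have f5 : excess φ {b, c, d} + excess φ {a, u} = excess φ {b, c} + excess φ {a, d, u} :=
    h.exchange ∅ _ _ _ _ (fun π h1 _ _ => h.tight_of_mem π h1)
      (fun π h1 _ _ => h.tight_of_pair π h1)
  have f6 : excess φ {b, c, d} + excess φ {a, u} = excess φ {b, c, d, a} + excess φ {u} :=
    h.exchange ∅ _ _ _ _ (fun π h1 _ _ => h.tight_of_mem π h1)
      (fun π h1 _ _ => h.tight_of_mem π h1)
  have f7 : excess φ {b, c, d} + excess φ {a, u} = excess φ {b, c, d, u} + excess φ {a} :=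
    h.exchange ∅ _ _ _ _ (fun π h1 _ _ => h.tight_of_mem π h1)
      (fun π h1 _ _ => h.tight_of_mem π h1)
  obtain ⟨k1, k2, -, k3, -⟩ := h.excess_paw
  simp only [excess_singleton] at f1 f2 f3 f4 f6 f7
  refine ⟨?_, ?_, ?_, ?_, ?_, ?_⟩ <;> linarith

theorem excess_two (h : ConstOnPawFace n K a b c d φ) {u v : ℕ}
    (hu : u ∈ Finset.Icc 1 n \ {a, b, c, d}) (hv : v ∈ Finset.Icc 1 n \ {a, b, c, d})
    (huv : u ≠ v) :
    excess φ {u, v} = excess φ {a, b} ∧ excess φ {a, b, u} = 2 * excess φ {a, b} ∧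
      excess φ {a, u, v} = 2 * excess φ {a, b} ∧ excess φ {d, u, v} = 2 * excess φ {a, b} := by
  obtain ⟨hK1, hK2, ha, hd, had, hb, hab, hdb, hbc, hcn, -⟩ := id h
  obtain ⟨-, -, -, -, -, k1⟩ := h.excess_one hu
  simp only [Finset.mem_sdiff, Finset.mem_insert, Finset.mem_singleton, not_or,
    Finset.mem_Icc] at hu hv
  obtain ⟨⟨hu1, hun⟩, hua, hub, huc, hud⟩ := hu
  obtain ⟨⟨hv1, hvn⟩, hva, hvb, hvc, hvd⟩ := hv
  have f1 : excess φ {b, c, d} + excess φ {u, v} = excess φ {b, c, d, u} + excess φ {v} :=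
    h.exchange ∅ _ _ _ _ (fun π h1 _ _ => h.tight_of_mem π h1)
      (fun π h1 _ _ => h.tight_of_mem π h1)
  have f2 : excess φ {a, b} + excess φ {u, v} = excess φ {a, b, u} + excess φ {v} :=
    h.exchange {c, d} _ _ _ _
      (fun π h1 _ ⟨D, hD, hs⟩ => h.tight_of_separate π h1 hD (by simp) (Or.inl (hs (by simp)))
        (by simp) (hs (by simp)))
      (fun π h1 _ ⟨D, hD, hs⟩ => h.tight_of_separate π h1 hD (by simp) (Or.inl (hs (by simp)))
        (by simp) (hs (by simp)))
  have f3 : excess φ {a, b} + excess φ {u, v} = excess φ {b} + excess φ {a, u, v} :=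
    h.exchange {c, d} _ _ _ _
      (fun π h1 _ ⟨D, hD, hs⟩ => h.tight_of_separate π h1 hD (by simp) (Or.inl (hs (by simp)))
        (by simp) (hs (by simp)))
      (fun π h1 h2 ⟨D, hD, hs⟩ => h.tight_of_singleton π h1 hD
        (fun h' => by
          have := π.eq_of_mem h2 hD (u := a) (by simp) h' ▸ hs (show c ∈ {c, d} by simp)
          simp only [Finset.mem_insert, Finset.mem_singleton] at this
          omega)
        (hs (by simp)) (hs (by simp)))
  have f4 : excess φ {c, d} + excess φ {u, v} = excess φ {c} + excess φ {d, u, v} :=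
    h.exchange {a, b} _ _ _ _
      (fun π h1 _ ⟨D, hD, hs⟩ => h.tight_of_separate π hD h1 (hs (by simp)) (by simp)
        (hs (by simp)) (by simp) (fun h' => by
          have := π.eq_of_mem h1 hD (u := c) (by simp) h' ▸ hs (show b ∈ {a, b} by simp)
          simp only [Finset.mem_insert, Finset.mem_singleton] at this
          omega))
      (fun π h1 _ ⟨D, hD, hs⟩ => h.tight_of_separate π hD h1 (hs (by simp)) (by simp)
        (hs (by simp)) (by simp) (fun h' => by
          have := π.eq_of_mem h1 hD (u := c) (by simp) h' ▸ hs (show b ∈ {a, b} by simp)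
          simp only [Finset.mem_singleton] at this
          omega))
  obtain ⟨-, k2, -, k3, -⟩ := h.excess_paw
  simp only [excess_singleton] at f1 f2 f3 f4
  refine ⟨?_, ?_, ?_, ?_⟩ <;> linarith

theorem excess_three (h : ConstOnPawFace n K a b c d φ) {u v w : ℕ}
    (hu : u ∈ Finset.Icc 1 n \ {a, b, c, d}) (hv : v ∈ Finset.Icc 1 n \ {a, b, c, d})
    (hw : w ∈ Finset.Icc 1 n \ {a, b, c, d}) (huv : u ≠ v) (huw : u ≠ w) (hvw : v ≠ w) :
    excess φ {u, v, w} = 2 * excess φ {a, b} := by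
  obtain ⟨hK1, hK2, ha, hd, had, hb, hab, hdb, hbc, hcn, hφ⟩ := id h
  have kuv := h.excess_two hu hv huv
  have kvw := h.excess_two hv hw hvw
  simp only [Finset.mem_sdiff, Finset.mem_insert, Finset.mem_singleton, not_or,
    Finset.mem_Icc] at hu hv hw
  obtain ⟨⟨hu1, hun⟩, hua, hub, huc, hud⟩ := hu
  obtain ⟨⟨hv1, hvn⟩, hva, hvb, hvc, hvd⟩ := hv
  obtain ⟨⟨hw1, hwn⟩, hwa, hwb, hwc, hwd⟩ := hw
  have hcard : ({a, b} : Finset ℕ).card + ({u, v, w} : Finset ℕ).card ≤ 5 := by clear * -; grind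
  suffices f : excess φ {a, b} + excess φ {u, v, w} = excess φ {a, b, u} + excess φ {v, w} by
    linarith
  by_cases hKn : K + 4 ≤ n
  · have hcd2 : ({c, d} : Finset ℕ).card ≤ 2 := Finset.card_le_two
    exact h.exchange {c, d} _ _ _ _
      (fun π h1 _ ⟨D, hD, hs⟩ => h.tight_of_separate π h1 hD (by simp) (Or.inl (hs (by simp)))
        (by simp) (hs (by simp)))
      (fun π h1 _ ⟨D, hD, hs⟩ => h.tight_of_separate π h1 hD (by simp) (Or.inl (hs (by simp)))
        (by simp) (hs (by simp)))
      (hcard' := by omega)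
  · have h7 : 7 ≤ n := by
      have hle := Finset.card_le_card (s := {a, b, c, d, u, v, w}) (t := Finset.Icc 1 n) (by
        simp only [Finset.insert_subset_iff, Finset.singleton_subset_iff, Finset.mem_Icc]
        omega)
      rw [Nat.card_Icc] at hle
      have : ({a, b, c, d, u, v, w} : Finset ℕ).card = 7 := by
        repeat rw [Finset.card_insert_of_notMem (by
          simp only [Finset.mem_insert, Finset.mem_singleton]; omega)]
        simp
      omega
    have h5 := (Finset.card_union_le {a, b} {u, v, w}).trans hcard
    refine excess_exchange hK1 hφ ∅ {c} {a, b} {u, v, w} {a, b, u} {v, w} (by simp) (by simp)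
      (by simp) (by simp) ?_ ?_ ?_ ?_ (by simp) ?_ (by simp)
      ?_ (by simp) (by omega) (by simp only [Finset.card_empty]; omega) (by simp; omega) ?_ ?_
    · rw [Finset.disjoint_left]
      intro x; simp only [Finset.mem_insert, Finset.mem_singleton]; omega
    · rw [Finset.disjoint_left]
      intro x; simp only [Finset.mem_insert, Finset.mem_singleton]; omega
    · clear * -
      ext x; simp only [Finset.mem_union, Finset.mem_insert, Finset.mem_singleton]; tauto
    · simp only [Finset.union_subset_iff, Finset.insert_subset_iff, Finset.singleton_subset_iff,
        Finset.mem_Icc]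
      omega
    · simp only [Finset.singleton_subset_iff, Finset.mem_Icc]; omega
    · rw [Finset.disjoint_left]
      intro x; simp only [Finset.mem_union, Finset.mem_insert, Finset.mem_singleton]; omega
    · exact fun π h1 _ _ hs => h.tight_of_separate π h1 (hs c (by simp))
    · exact fun π h1 _ _ hs => h.tight_of_separate π h1 (hs c (by simp))

theorem exists_ne (h : ConstOnPawFace n K a b c d φ) (u : ℕ) :
    ∃ v ∈ Finset.Icc 1 n \ {a, b, c, d}, v ≠ u := by
  have := h.three_le
  have := h.add_three_le
  obtain ⟨v, hv, hv'⟩ := Finset.exists_mem_notMem_of_card_lt_card (s := {a, b, c, d, u})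
    (t := Finset.Icc 1 n) (Finset.card_le_five.trans_lt (by rw [Nat.card_Icc]; omega))
  simp only [Finset.mem_insert, Finset.mem_singleton, not_or] at hv'
  exact ⟨v, by simp only [Finset.mem_sdiff, Finset.mem_insert, Finset.mem_singleton]; tauto,
    hv'.2.2.2.2⟩

theorem excess_pair_eq (h : ConstOnPawFace n K a b c d φ) {x y : ℕ}
    (hx : x ∈ Finset.Icc 1 n \ {b, c}) (hy : y ∈ Finset.Icc 1 n \ {b, c}) (hxy : x ≠ y) :
    excess φ {x, y} = excess φ {a, b} := by
  obtain ⟨-, -, had, -⟩ := h.excess_paw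
  have h1 (u : ℕ) (hu : u ∈ Finset.Icc 1 n \ {a, b, c, d}) := h.excess_one hu
  have h2 := fun hu hv => (h.excess_two (u := x) (v := y) hu hv hxy).1
  have e (z : ℕ) (hz : z ∈ Finset.Icc 1 n \ {b, c}) (hza : z ≠ a) (hzd : z ≠ d) :
      z ∈ Finset.Icc 1 n \ {a, b, c, d} := by
    simp only [Finset.mem_sdiff, Finset.mem_insert, Finset.mem_singleton] at hz ⊢
    tauto
  by_cases hxa : x = a
  · subst hxa
    by_cases hyd : y = d
    · exact hyd ▸ had
    · exact (h1 y (e y hy hxy.symm hyd)).1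
  by_cases hxd : x = d
  · subst hxd
    by_cases hya : y = a
    · rw [hya, Finset.pair_comm, had]
    · exact (h1 y (e y hy hya hxy.symm)).2.1
  have hx' := e x hx hxa hxd
  by_cases hya : y = a
  · rw [hya, Finset.pair_comm, (h1 x hx').1]
  by_cases hyd : y = d
  · rw [hyd, Finset.pair_comm, (h1 x hx').2.1]
  exact h2 hx' (e y hy hya hyd)

theorem excess_triple_of_a (h : ConstOnPawFace n K a b c d φ) {y z : ℕ}
    (hy : y ∈ Finset.Icc 1 n \ {b, c}) (hz : z ∈ Finset.Icc 1 n \ {b, c}) (hya : y ≠ a)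
    (hza : z ≠ a) (hyz : y ≠ z) : excess φ {a, y, z} = 2 * excess φ {a, b} := by
  have e (w : ℕ) (hw : w ∈ Finset.Icc 1 n \ {b, c}) (hwa : w ≠ a) (hwd : w ≠ d) :
      w ∈ Finset.Icc 1 n \ {a, b, c, d} := by
    simp only [Finset.mem_sdiff, Finset.mem_insert, Finset.mem_singleton] at hw ⊢
    tauto
  by_cases hyd : y = d
  · subst hyd
    exact (h.excess_one (e z hz hza hyz.symm)).2.2.2.1
  by_cases hzd : z = d
  · rw [hzd, Finset.pair_comm]
    exact (h.excess_one (e y hy hya hyd)).2.2.2.1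
  exact (h.excess_two (e y hy hya hyd) (e z hz hza hzd) hyz).2.2.1

theorem excess_triple_eq (h : ConstOnPawFace n K a b c d φ) {x y z : ℕ}
    (hx : x ∈ Finset.Icc 1 n \ {b, c}) (hy : y ∈ Finset.Icc 1 n \ {b, c})
    (hz : z ∈ Finset.Icc 1 n \ {b, c}) (hxy : x ≠ y) (hxz : x ≠ z) (hyz : y ≠ z) :
    excess φ {x, y, z} = 2 * excess φ {a, b} := by
  by_cases hxa : x = a
  · subst hxa
    exact h.excess_triple_of_a hy hz hxy.symm hxz.symm hyz
  by_cases hya : y = a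
  · subst hya
    rw [Finset.insert_comm]
    exact h.excess_triple_of_a hx hz hxy hyz.symm hxz
  by_cases hza : z = a
  · subst hza
    rw [Finset.pair_comm, Finset.insert_comm]
    exact h.excess_triple_of_a hx hy hxz hyz hxy
  have e (w : ℕ) (hw : w ∈ Finset.Icc 1 n \ {b, c}) (hwa : w ≠ a) (hwd : w ≠ d) :
      w ∈ Finset.Icc 1 n \ {a, b, c, d} := by
    simp only [Finset.mem_sdiff, Finset.mem_insert, Finset.mem_singleton] at hw ⊢
    tauto
  by_cases hxd : x = d
  · subst hxd
    exact (h.excess_two (e y hy hya hxy.symm) (e z hz hza hxz.symm) hyz).2.2.2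
  by_cases hyd : y = d
  · subst hyd
    rw [Finset.insert_comm]
    exact (h.excess_two (e x hx hxa hxy) (e z hz hza hyz.symm) hxz).2.2.2
  by_cases hzd : z = d
  · subst hzd
    rw [Finset.pair_comm, Finset.insert_comm]
    exact (h.excess_two (e x hx hxa hxz) (e y hy hya hyz) hxy).2.2.2
  exact h.excess_three (e x hx hxa hxd) (e y hy hya hyd) (e z hz hza hzd) hxy hxz hyz

theorem mem_of_le_three (h : ConstOnPawFace n K a b c d φ) {x : ℕ} (hx : 1 ≤ x) (hx3 : x ≤ 3) :
    x ∈ Finset.Icc 1 n \ {b, c} := by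
  have := h.three_le
  have := h.add_three_le
  have := h.four_le_b
  have := h.b_lt_c
  simp only [Finset.mem_sdiff, Finset.mem_insert, Finset.mem_singleton, Finset.mem_Icc]
  omega

theorem excess_ab_eq_zero (h : ConstOnPawFace n K a b c d φ) : excess φ {a, b} = 0 := by
  have h1 := h.mem_of_le_three (x := 1) (by norm_num) (by norm_num)
  have h2 := h.mem_of_le_three (x := 2) (by norm_num) (by norm_num)
  have h3 := h.mem_of_le_three (x := 3) (by norm_num) (by norm_num)
  have e12 := h.excess_pair_eq h1 h2 (by norm_num)
  have e13 := h.excess_pair_eq h1 h3 (by norm_num)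
  have e23 := h.excess_pair_eq h2 h3 (by norm_num)
  have e := h.excess_triple_eq h1 h2 h3 (by norm_num) (by norm_num) (by norm_num)
  have r (x : ℕ) (hx : x < 4) := repCoeff_of_lt_four φ hx
  rw [excess_pair φ (by norm_num), r _ (by norm_num), r _ (by norm_num), r _ (by norm_num)]
    at e12 e13 e23
  rw [excess_triple φ (by norm_num) (by norm_num) (by norm_num), r _ (by norm_num),
    r _ (by norm_num), r _ (by norm_num), r _ (by norm_num)] at e
  linarith

theorem repCoeff_eq_zero_of_mem (h : ConstOnPawFace n K a b c d φ) {z : ℕ}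
    (hz : z ∈ Finset.Icc 1 n \ {b, c}) : repCoeff φ z = 0 := by
  by_cases hz4 : z < 4
  · exact repCoeff_of_lt_four φ hz4
  have h1 := h.mem_of_le_three (x := 1) (by norm_num) (by norm_num)
  have h2 := h.mem_of_le_three (x := 2) (by norm_num) (by norm_num)
  have e12 := h.excess_pair_eq h1 h2 (by norm_num)
  have e1 := h.excess_pair_eq h1 hz (by omega)
  have e2 := h.excess_pair_eq h2 hz (by omega)
  have e := h.excess_triple_eq h1 h2 hz (by norm_num) (by omega) (by omega)
  have r (x : ℕ) (hx : x < 4) := repCoeff_of_lt_four φ hx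
  rw [excess_pair φ (by norm_num), r _ (by norm_num), r 1 (by norm_num), r 2 (by norm_num)]
    at e12
  rw [excess_pair φ (by omega), r (min _ _) (by omega), r _ (by norm_num)] at e1 e2
  rw [excess_triple φ (by norm_num) (by omega) (by omega), r (min _ _) (by omega),
    r 1 (by norm_num), r 2 (by norm_num)] at e
  linarith [h.excess_ab_eq_zero]

theorem edgeCoeff_eq_zero_of_mem (h : ConstOnPawFace n K a b c d φ) {x y : ℕ}
    (hx : x ∈ Finset.Icc 1 n \ {b, c}) (hy : y ∈ Finset.Icc 1 n \ {b, c}) (hxy : x ≠ y) :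
    edgeCoeff φ x y = 0 := by
  have e := h.excess_pair_eq hx hy hxy
  have hm : repCoeff φ (min x y) = 0 := by
    rcases min_choice x y with h' | h' <;> rw [h']
    exacts [h.repCoeff_eq_zero_of_mem hx, h.repCoeff_eq_zero_of_mem hy]
  rw [excess_pair φ hxy, hm, h.repCoeff_eq_zero_of_mem hx, h.repCoeff_eq_zero_of_mem hy,
    h.excess_ab_eq_zero] at e
  linarith

/-- Without representative coefficient at `b`, the remaining coefficients vanish as well. -/
theorem coeff_eq_zero (h : ConstOnPawFace n K a b c d φ) (hβ : repCoeff φ b = 0) :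
    repCoeff φ c = 0 ∧ edgeCoeff φ b c = 0 ∧
      ∀ x ∈ Finset.Icc 1 n \ {b, c}, edgeCoeff φ b x = 0 ∧ edgeCoeff φ c x = 0 := by
  obtain ⟨hK1, hK2, ha, hd, had, hb, hab, hdb, hbc, hcn, -⟩ := id h
  have hκ := h.excess_ab_eq_zero
  obtain ⟨kbc, kcd, -, kbcd, kabd⟩ := h.excess_paw
  have haU : a ∈ Finset.Icc 1 n \ {b, c} := by
    simp only [Finset.mem_sdiff, Finset.mem_insert, Finset.mem_singleton, Finset.mem_Icc]; omega
  have hdU : d ∈ Finset.Icc 1 n \ {b, c} := by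
    simp only [Finset.mem_sdiff, Finset.mem_insert, Finset.mem_singleton, Finset.mem_Icc]; omega
  have ra := h.repCoeff_eq_zero_of_mem haU
  have rd := h.repCoeff_eq_zero_of_mem hdU
  have qad := h.edgeCoeff_eq_zero_of_mem haU hdU had
  have rmin : repCoeff φ (min a d) = 0 := by
    rcases min_choice a d with h' | h' <;> rw [h'] <;> assumption
  have qab : edgeCoeff φ a b = 0 := by
    rw [excess_pair φ hab.ne, min_eq_left hab.le] at hκ
    linarith
  have qbc : edgeCoeff φ b c = repCoeff φ c := by
    rw [excess_pair φ hbc.ne, min_eq_left hbc.le] at kbc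
    linarith
  have qcd : edgeCoeff φ c d = repCoeff φ c := by
    rw [excess_pair φ (by omega), min_eq_right (by omega)] at kcd
    linarith
  have qbd : edgeCoeff φ b d = 0 := by
    rw [excess_triple φ hab.ne had hdb.ne', min_eq_right hdb.le] at kabd
    linarith
  have rc : repCoeff φ c = 0 := by
    rw [excess_triple φ hbc.ne hdb.ne' (by omega), min_eq_right (a := c) (by omega),
      min_eq_right hdb.le] at kbcd
    linarith
  have qac : edgeCoeff φ c a = 0 := by
    obtain ⟨u, hu, -⟩ := h.exists_ne 0
    have k := (h.excess_one hu).2.2.2.2.1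
    rw [excess_quadruple φ (by omega) (by omega) (by omega) (by omega) (by omega) had.symm,
      show min b (min c (min d a)) = min a d by omega, edgeCoeff_comm φ b a,
      edgeCoeff_comm φ d a] at k
    linarith
  refine ⟨rc, qbc.trans rc, fun u hu => ?_⟩
  by_cases hua : u = a
  · exact hua ▸ ⟨edgeCoeff_comm φ a b ▸ qab, qac⟩
  by_cases hud : u = d
  · exact hud ▸ ⟨qbd, qcd.trans rc⟩
  have hu' : u ∈ Finset.Icc 1 n \ {a, b, c, d} := by
    simp only [Finset.mem_sdiff, Finset.mem_insert, Finset.mem_singleton] at hu ⊢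
    tauto
  obtain ⟨v, hv, hvu⟩ := h.exists_ne u
  have k1 := (h.excess_two hu' hv hvu.symm).2.1
  have k2 := (h.excess_one hu').2.2.1
  have ru := h.repCoeff_eq_zero_of_mem hu
  have qau := h.edgeCoeff_eq_zero_of_mem haU hu (Ne.symm hua)
  have qdu := h.edgeCoeff_eq_zero_of_mem hdU hu (Ne.symm hud)
  simp only [Finset.mem_sdiff, Finset.mem_insert, Finset.mem_singleton, not_or] at hu
  have m1 : repCoeff φ (min a (min b u)) = 0 := by
    rcases min_choice a u with h' | h' <;>
      rw [show min a (min b u) = min a u by omega, h'] <;> assumption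
  have m2 : repCoeff φ (min c (min d u)) = 0 := by
    rcases min_choice d u with h' | h' <;>
      rw [show min c (min d u) = min d u by omega, h'] <;> assumption
  rw [excess_triple φ hab.ne (Ne.symm hua) (Ne.symm hu.2.1), m1] at k1
  rw [excess_triple φ (by omega) (Ne.symm hu.2.2) (Ne.symm hud), m2] at k2
  constructor <;> linarith

theorem map_charVec_eq (h : ConstOnPawFace n K a b c d φ) (hβ : repCoeff φ b = 0)
    (π π' : KPartition n K) : φ (charVec n K π) = φ (charVec n K π') := by
  obtain ⟨rc, qbc, q⟩ := h.coeff_eq_zero hβ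
  have e (x : ℕ) (hx : x ∈ Finset.Icc 1 n) :
      x = b ∨ x = c ∨ x ∈ Finset.Icc 1 n \ {b, c} := by
    simp only [Finset.mem_sdiff, Finset.mem_insert, Finset.mem_singleton]
    tauto
  have hq : ∀ u ∈ Finset.Icc 1 n, ∀ v ∈ Finset.Icc 1 n, u ≠ v → edgeCoeff φ u v = 0 := by
    intro u hu v hv huv
    rcases e u hu with rfl | rfl | hu' <;> rcases e v hv with rfl | rfl | hv'
    · exact absurd rfl huv
    · exact qbc
    · exact (q v hv').1
    · exact edgeCoeff_comm φ u v ▸ qbc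
    · exact absurd rfl huv
    · exact (q v hv').2
    · exact edgeCoeff_comm φ u v ▸ (q u hu').1
    · exact edgeCoeff_comm φ u v ▸ (q u hu').2
    · exact h.edgeCoeff_eq_zero_of_mem hu' hv' huv
  have hr : ∀ u ∈ Finset.Icc 1 n, repCoeff φ u = 0 := by
    intro u hu
    rcases e u hu with rfl | rfl | hu'
    exacts [hβ, rc, h.repCoeff_eq_zero_of_mem hu']
  rw [map_charVec_of_coeff_eq_zero φ hq hr, map_charVec_of_coeff_eq_zero φ hq hr]

end ConstOnPawFace

theorem KPartition.parts_injective {n K : ℕ} :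
    Function.Injective (KPartition.parts : KPartition n K → Finset (Finset ℕ)) := by
  rintro ⟨p, _, _, _, _⟩ ⟨q, _, _, _, _⟩ (rfl : p = q)
  rfl

instance KPartition.finite (n K : ℕ) : Finite (KPartition n K) :=
  Finite.of_injective (β := (Finset.Icc 1 n).powerset.powerset)
    (fun π => ⟨π.parts, Finset.mem_powerset.mpr fun _ hC =>
      Finset.mem_powerset.mpr (π.subset_Icc hC)⟩)
    fun _ _ h => KPartition.parts_injective (congrArg Subtype.val h)

theorem charVec_mem_PolyP {n K : ℕ} (π : KPartition n K) : charVec n K π ∈ PolyP n K :=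
  subset_convexHull ℝ _ ⟨π, rfl⟩

theorem map_le_of_mem_PolyP {n K : ℕ} {f : GPoint →ₗ[ℝ] ℝ} {β : ℝ}
    (hf : ∀ π, f (charVec n K π) ≤ β) : ∀ x ∈ PolyP n K, f x ≤ β :=
  convexHull_min (by rintro _ ⟨π, rfl⟩; exact hf π) (convex_halfSpace_le f.isLinear β)

theorem vectorSpan_PolyP (n K : ℕ) :
    vectorSpan ℝ (PolyP n K) = vectorSpan ℝ (Set.range (charVec n K)) := by
  rw [← direction_affineSpan, ← direction_affineSpan, PolyP, affineSpan_convexHull]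
  congr 2
  ext x
  simp [eq_comm]

instance finiteDimensional_vectorSpan_PolyP (n K : ℕ) :
    FiniteDimensional ℝ (vectorSpan ℝ (PolyP n K)) := by
  rw [vectorSpan_PolyP]
  exact finiteDimensional_vectorSpan_of_finite ℝ (Set.finite_range _)

theorem vectorSpan_le_ker {f : GPoint →ₗ[ℝ] ℝ} {s : Set GPoint} {β : ℝ}
    (hs : ∀ x ∈ s, f x = β) : vectorSpan ℝ s ≤ LinearMap.ker f := by
  rw [vectorSpan_def, Submodule.span_le]
  rintro _ ⟨x, hx, y, hy, rfl⟩
  simp [hs x hx, hs y hy]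

/-- A valid inequality is facet-defining if every functional constant on its tight vertices is,
up to a multiple of the inequality, constant on all vertices. -/
theorem isFacetLe_of_forall {n K : ℕ} {f : GPoint →ₗ[ℝ] ℝ} {β : ℝ}
    (hf : ∀ π, f (charVec n K π) ≤ β) {π₀ π₁ : KPartition n K} (h₀ : f (charVec n K π₀) = β)
    (h₁ : f (charVec n K π₁) ≠ β)
    (h : ∀ φ : GPoint →ₗ[ℝ] ℝ, (∀ π π' : KPartition n K, f (charVec n K π) = β →
      f (charVec n K π') = β → φ (charVec n K π) = φ (charVec n K π')) →
      ∃ r : ℝ, ∀ π π' : KPartition n K,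
        (φ - r • f) (charVec n K π) = (φ - r • f) (charVec n K π')) :
    IsFacetLe n K f β := by
  refine ⟨map_le_of_mem_PolyP hf, ?_⟩
  rw [adim, adim, direction_affineSpan, direction_affineSpan]
  set F := {x | x ∈ PolyP n K ∧ f x = β}
  have hFP : vectorSpan ℝ F ≤ vectorSpan ℝ (PolyP n K) := vectorSpan_mono ℝ fun x hx => hx.1
  have : FiniteDimensional ℝ (vectorSpan ℝ F) := Submodule.finiteDimensional_of_le hFP
  have hmem (π : KPartition n K) (hπ : f (charVec n K π) = β) : charVec n K π ∈ F :=
    ⟨charVec_mem_PolyP π, hπ⟩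
  set v := charVec n K π₁ - charVec n K π₀
  have hv : f v ≠ 0 := by
    rw [map_sub, h₀]
    exact sub_ne_zero.mpr h₁
  have hle : vectorSpan ℝ (PolyP n K) ≤ vectorSpan ℝ F ⊔ Submodule.span ℝ {v} := by
    rw [vectorSpan_PolyP, vectorSpan_eq_span_vsub_set_right ℝ (Set.mem_range_self π₀),
      Submodule.span_le]
    rintro _ ⟨_, ⟨π, rfl⟩, rfl⟩
    by_contra hz
    obtain ⟨φ, hφz, hφ⟩ := Submodule.exists_le_ker_of_notMem hz
    obtain ⟨r, hr⟩ := h φ fun π π' hπ hπ' => by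
      have := hφ (Submodule.mem_sup_left (vsub_mem_vectorSpan ℝ (hmem π hπ) (hmem π' hπ')))
      rwa [LinearMap.mem_ker, vsub_eq_sub, map_sub, sub_eq_zero] at this
    have hφv : φ v = 0 := hφ (Submodule.mem_sup_right (Submodule.mem_span_singleton_self v))
    have hrv : r * f v = 0 := by
      have := hr π₁ π₀
      simp only [LinearMap.sub_apply, LinearMap.smul_apply, smul_eq_mul] at this
      rw [map_sub] at hφv ⊢
      linarith
    have hr0 : r = 0 := (mul_eq_zero.mp hrv).resolve_right hv
    refine hφz ?_
    have := hr π π₀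
    rw [hr0, zero_smul, sub_zero] at this
    simp [this]
  refine le_antisymm (Submodule.finrank_lt_finrank_of_lt (lt_of_le_of_ne hFP fun heq => hv ?_)) ?_
  · have hvP : v ∈ vectorSpan ℝ F :=
      heq ▸ vsub_mem_vectorSpan ℝ (charVec_mem_PolyP π₁) (charVec_mem_PolyP π₀)
    exact vectorSpan_le_ker (fun x (hx : x ∈ F) => hx.2) hvP
  · calc Module.finrank ℝ (vectorSpan ℝ (PolyP n K))
        ≤ Module.finrank ℝ ↥(vectorSpan ℝ F ⊔ Submodule.span ℝ {v}) :=
          Submodule.finrank_mono hle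
      _ ≤ Module.finrank ℝ (vectorSpan ℝ F) + Module.finrank ℝ (Submodule.span ℝ {v}) :=
          Submodule.finrank_add_le_finrank_add_finrank _ _
      _ = Module.finrank ℝ (vectorSpan ℝ F) + 1 := by
          rw [finrank_span_singleton fun h0 => hv (by rw [h0, map_zero])]

/-- If the face of an inequality lies in a strictly larger proper face, then the inequality is not
facet-defining. -/
theorem not_isFacetLe_of_forall {n K : ℕ} {f g : GPoint →ₗ[ℝ] ℝ} {β γ : ℝ}
    (hg : ∀ π, g (charVec n K π) ≤ γ) (hfg : ∀ π, (f - g) (charVec n K π) ≤ β - γ)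
    {π₀ π₁ π₂ : KPartition n K} (h₀ : f (charVec n K π₀) = β)
    (h₁ : g (charVec n K π₁) = γ) (h₁' : f (charVec n K π₁) ≠ β)
    (h₂ : g (charVec n K π₂) ≠ γ) : ¬IsFacetLe n K f β := by
  rintro ⟨-, hdim⟩
  rw [adim, adim, direction_affineSpan, direction_affineSpan] at hdim
  set F := {x | x ∈ PolyP n K ∧ f x = β}
  set G := {x | x ∈ PolyP n K ∧ g x = γ}
  have hFG : F ⊆ G := by
    rintro x ⟨hx, hfx⟩
    have h1 := map_le_of_mem_PolyP hg x hx
    have h2 := map_le_of_mem_PolyP hfg x hx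
    rw [LinearMap.sub_apply] at h2
    exact ⟨hx, by linarith⟩
  have hGP : vectorSpan ℝ G ≤ vectorSpan ℝ (PolyP n K) := vectorSpan_mono ℝ fun x hx => hx.1
  have : FiniteDimensional ℝ (vectorSpan ℝ G) := Submodule.finiteDimensional_of_le hGP
  have hF₀ : charVec n K π₀ ∈ F := ⟨charVec_mem_PolyP π₀, h₀⟩
  have h1 := Submodule.finrank_lt_finrank_of_lt <| lt_of_le_of_ne (vectorSpan_mono ℝ hFG) <| by
    intro heq
    have hm := vsub_mem_vectorSpan ℝ (s := G) ⟨charVec_mem_PolyP π₁, h₁⟩ (hFG hF₀)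
    rw [← heq] at hm
    have := vectorSpan_le_ker (fun x (hx : x ∈ F) => hx.2) hm
    rw [LinearMap.mem_ker, vsub_eq_sub, map_sub, h₀, sub_eq_zero] at this
    exact h₁' this
  have h2 := Submodule.finrank_lt_finrank_of_lt <| lt_of_le_of_ne hGP <| by
    intro heq
    have hm := vsub_mem_vectorSpan ℝ (charVec_mem_PolyP π₂) (charVec_mem_PolyP π₀)
    rw [← heq] at hm
    have := vectorSpan_le_ker (fun x (hx : x ∈ G) => hx.2) hm
    rw [LinearMap.mem_ker, vsub_eq_sub, map_sub, (hFG hF₀).2, sub_eq_zero] at this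
    exact h₂ this
  omega

theorem exists_partition {n K : ℕ} (hK1 : 3 ≤ K) (hK2 : K + 3 ≤ n) (A B : Finset ℕ)
    (hA : A.Nonempty := by simp) (hB : B.Nonempty := by simp)
    (hAB : ∀ x ∈ A, x ∉ B := by
      intro x; simp only [Finset.mem_insert, Finset.mem_singleton]; omega)
    (hsub : A ∪ B ⊆ Finset.Icc 1 n := by
      simp only [Finset.union_subset_iff, Finset.insert_subset_iff, Finset.singleton_subset_iff,
        Finset.mem_Icc]
      omega)
    (hcard : A.card + B.card ≤ 5 := by clear * -; grind) :
    ∃ π : KPartition n K, A ∈ π.parts ∧ B ∈ π.parts := by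
  have := Finset.card_union_le A B
  obtain ⟨T, -, -, hT⟩ := exists_filling hK1 (A ∪ B) ∅ ∅ hsub (by simp) (by simp) (by simp)
    (by simp) (by simp) (by omega) (by simp only [Finset.card_empty]; omega) (by simpa using hK1)
  obtain ⟨-, -, π, hπ⟩ := hT A B hA hB (Finset.disjoint_left.mpr hAB) rfl
  exact ⟨π, by simp [hπ], by simp [hπ]⟩

theorem pawMap_charVec_le {n K a b c d : ℕ} (hb : 4 ≤ b) (hab : a < b) (hdb : d < b)
    (hbc : b < c) (hcn : c ≤ n) (π : KPartition n K) : pawMap a b c d (charVec n K π) ≤ 2 := by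
  obtain ⟨C, hC, hbC⟩ := π.exists_mem (u := b) (Finset.mem_Icc.mpr ⟨by omega, by omega⟩)
  obtain ⟨D, hD, hcD⟩ := π.exists_mem (u := c) (Finset.mem_Icc.mpr ⟨by omega, by omega⟩)
  rw [pawMap_charVec hb (by omega) π hC hD hbC hcD]
  have hb' : a ∈ C → ¬∀ w ∈ C, b ≤ w := fun h h' => absurd (h' a h) (by omega)
  have hd' : d ∈ C → ¬∀ w ∈ C, b ≤ w := fun h h' => absurd (h' d h) (by omega)
  have hc' : d ∈ D → ¬∀ w ∈ D, c ≤ w := fun h h' => absurd (h' d h) (by omega)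
  by_cases hcC : c ∈ C
  · obtain rfl := π.eq_of_mem hC hD hcC hcD
    have hc'' : ¬∀ w ∈ C, c ≤ w := fun h' => absurd (h' b hbC) (by omega)
    rw [if_pos hcC, if_neg hc'']
    split_ifs <;> first | norm_num; done | tauto
  · rw [if_neg hcC]
    split_ifs <;> first | norm_num; done | tauto

theorem isFacetLe_paw {n K a b c d : ℕ} (hK1 : 3 ≤ K) (hK2 : K + 3 ≤ n) (ha : 1 ≤ a)
    (hd : 1 ≤ d) (had : a ≠ d) (hb : 4 ≤ b) (hab : a < b) (hdb : d < b) (hbc : b < c)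
    (hcn : c ≤ n) : IsFacetLe n K (pawMap a b c d) 2 := by
  obtain ⟨π₀, h₀, -⟩ := exists_partition hK1 hK2 {b, c, d} {a}
  obtain ⟨π₁, h₁, h₁'⟩ := exists_partition hK1 hK2 {a, c} {b}
  refine isFacetLe_of_forall (pawMap_charVec_le hb hab hdb hbc hcn) (π₀ := π₀) (π₁ := π₁)
    (pawMap_eq_two_of_mem hb hdb hbc π₀ h₀ (by simp) (by simp) (by simp)) ?_ ?_
  · rw [pawMap_charVec hb (by omega) π₁ h₁' h₁ (by simp) (by simp)]
    have : ¬c ≤ a := by omega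
    simp [hab.ne, hbc.ne', had.symm, this, show d ≠ c by omega]
  · intro φ hφ
    have h : ConstOnPawFace n K a b c d (φ - repCoeff φ b • pawMap a b c d) :=
      ⟨hK1, hK2, ha, hd, had, hb, hab, hdb, hbc, hcn, fun π π' hπ hπ' => by
        simp only [LinearMap.sub_apply, LinearMap.smul_apply, hπ, hπ', hφ π π' hπ hπ']⟩
    refine ⟨repCoeff φ b, h.map_charVec_eq ?_⟩
    simp [repCoeff, hb, pawMap_apply, hbc.ne']

/-- The functional `x_{c,d} + x_c`. -/
noncomputable def edgeRepMap (c d : ℕ) : GPoint →ₗ[ℝ] ℝ where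
  toFun x := x.1 (c, d) + x.2 c
  map_add' x y := by simp only [Prod.fst_add, Prod.snd_add, Pi.add_apply]; ring
  map_smul' r x := by
    simp only [Prod.smul_fst, Prod.smul_snd, Pi.smul_apply, smul_eq_mul, RingHom.id_apply]; ring

theorem edgeRepMap_charVec {n K c d : ℕ} (hc : 4 ≤ c) (π : KPartition n K) {D : Finset ℕ}
    (hD : D ∈ π.parts) (hcD : c ∈ D) : edgeRepMap c d (charVec n K π) =
      (if d ∈ D then 1 else 0) + (if ∀ w ∈ D, c ≤ w then 1 else 0) := by
  change (charVec n K π).1 (c, d) + (charVec n K π).2 c = _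
  rw [charVec_edge π hD hcD, charVec_rep π hD hcD]
  simp only [hc, true_and]

theorem not_isFacetLe_paw {n K a b c d : ℕ} (hK1 : 3 ≤ K) (hK2 : K + 3 ≤ n) (ha : 1 ≤ a)
    (hd : 1 ≤ d) (had : a ≠ d) (hac : a ≠ c) (hc : 4 ≤ c) (hab : a < b) (hdc : d < c)
    (hcb : c < b) (hbn : b ≤ n) : ¬IsFacetLe n K (pawMap a b c d) 2 := by
  obtain ⟨u, hu1, hu3, hua, hud⟩ : ∃ u, 1 ≤ u ∧ u ≤ 3 ∧ u ≠ a ∧ u ≠ d := by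
    by_cases h1 : a = 1 ∨ d = 1
    · by_cases h2 : a = 2 ∨ d = 2
      · exact ⟨3, by omega⟩
      · exact ⟨2, by omega⟩
    · exact ⟨1, by omega⟩
  obtain ⟨π₀, h₀, -⟩ := exists_partition hK1 hK2 {b, c, d} {a}
  obtain ⟨π₁, h₁, h₁'⟩ := exists_partition hK1 hK2 {a, c, d} {b}
  obtain ⟨π₂, h₂, -⟩ := exists_partition hK1 hK2 {c, u} {b}
  have hcd : ¬c ≤ d := by omega
  have hbd : ¬b ≤ d := by omega
  have hcu : ¬c ≤ u := by omega
  refine not_isFacetLe_of_forall (g := edgeRepMap c d) (γ := 1) ?_ ?_ (π₀ := π₀) (π₁ := π₁)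
    (π₂ := π₂) ?_ ?_ ?_ ?_
  · intro π
    obtain ⟨D, hD, hcD⟩ := π.exists_mem (u := c) (Finset.mem_Icc.mpr ⟨by omega, by omega⟩)
    have hc' : d ∈ D → ¬∀ w ∈ D, c ≤ w := fun h h' => absurd (h' d h) (by omega)
    rw [edgeRepMap_charVec hc π hD hcD]
    split_ifs <;> first | norm_num; done | tauto
  · intro π
    obtain ⟨C, hC, hbC⟩ := π.exists_mem (u := b) (Finset.mem_Icc.mpr ⟨by omega, by omega⟩)
    obtain ⟨D, hD, hcD⟩ := π.exists_mem (u := c) (Finset.mem_Icc.mpr ⟨by omega, by omega⟩)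
    rw [LinearMap.sub_apply, edgeRepMap_charVec hc π hD hcD,
      pawMap_charVec (by omega) hc π hC hD hbC hcD]
    suffices h : ((if a ∈ C then 1 else 0) + (if c ∈ C then 1 else 0) - (if a ∈ D then 1 else 0)
        + (if ∀ w ∈ C, b ≤ w then 1 else 0) : ℝ) ≤ 1 by linarith
    have hb' : a ∈ C → ¬∀ w ∈ C, b ≤ w := fun h h' => absurd (h' a h) (by omega)
    by_cases hcC : c ∈ C
    · obtain rfl := π.eq_of_mem hC hD hcC hcD
      have hb'' : ¬∀ w ∈ C, b ≤ w := fun h' => absurd (h' c hcC) (by omega)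
      rw [if_pos hcC, if_neg hb'']
      linarith
    · rw [if_neg hcC]
      split_ifs <;> first | norm_num; done | tauto
  · rw [pawMap_charVec (by omega) hc π₀ h₀ h₀ (by simp) (by simp)]
    simp [hab.ne, hac, had, hcd, hbd]
    norm_num
  · rw [edgeRepMap_charVec hc π₁ h₁ (by simp)]
    simp [hcd]
  · rw [pawMap_charVec (by omega) hc π₁ h₁' h₁ (by simp) (by simp)]
    simp [hab.ne, hcb.ne, hcd]
  · rw [edgeRepMap_charVec hc π₂ h₂ (by simp)]
    simp [hdc.ne, hud.symm, hcu]

theorem lt_of_pawMap_le {n K a b c d : ℕ} (hK1 : 3 ≤ K) (hK2 : K + 3 ≤ n) (ha : 1 ≤ a)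
    (hd : 1 ≤ d) (hb : 4 ≤ b) (hc : 4 ≤ c) (hbn : b ≤ n) (hcn : c ≤ n) (han : a ≤ n)
    (hdn : d ≤ n) (hab : a ≠ b) (hac : a ≠ c) (had : a ≠ d) (hbc : b ≠ c) (hbd : b ≠ d)
    (hcd : c ≠ d) (h : ∀ π : KPartition n K, pawMap a b c d (charVec n K π) ≤ 2) :
    a < b ∧ d < c ∧ (b < c → d < b) := by
  refine ⟨?_, ?_, ?_⟩
  · by_contra! hba
    obtain ⟨π, h1, h2⟩ := exists_partition hK1 hK2 {a, b} {c}
    have := h π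
    rw [pawMap_charVec hb hc π h1 h2 (by simp) (by simp)] at this
    simp [hac, hac.symm, hbc.symm, hcd.symm, hba] at this
    norm_num at this
  · by_contra! hcd'
    obtain ⟨π, h1, h2⟩ := exists_partition hK1 hK2 {c, d} {b}
    have := h π
    rw [pawMap_charVec hb hc π h2 h1 (by simp) (by simp)] at this
    simp [hab, hac, had, hbc.symm, hcd'] at this
    norm_num at this
  · intro hbc'
    by_contra! hbd'
    obtain ⟨π, h1, -⟩ := exists_partition hK1 hK2 {b, c, d} {a}
    have := h π
    rw [pawMap_charVec hb hc π h1 h1 (by simp) (by simp)] at this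
    have hcb : ¬c ≤ b := by omega
    simp [hab, hac, had, hbc'.le, hbd', hcb] at this
    norm_num at this

/-- For `n ≥ 6`, `3 ≤ K ≤ n-3` and pairwise distinct `a, b, c, d ∈ V` with
`b, c ∈ {4,…,n}`, the paw inequality
`x_{a,b} + x_{b,c} - x_{a,c} + x_{c,d} + x_b + x_c ≤ 2` is facet-defining for `P_{n,K}` iff
`d < b < c` and `a < b`. -/
theorem paw_facet (n K a b c d : ℕ) (hn : 6 ≤ n) (hK1 : 3 ≤ K) (hK2 : K ≤ n - 3)
    (ha : a ∈ Finset.Icc 1 n) (hb : b ∈ Finset.Icc 4 n) (hc : c ∈ Finset.Icc 4 n)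
    (hd : d ∈ Finset.Icc 1 n)
    (hab : a ≠ b) (hac : a ≠ c) (had : a ≠ d) (hbc : b ≠ c) (hbd : b ≠ d) (hcd : c ≠ d) :
    IsFacetLe n K
        (fun x => x.1 (a, b) + x.1 (b, c) - x.1 (a, c) + x.1 (c, d) + x.2 b + x.2 c) 2 ↔
      (d < b ∧ b < c ∧ a < b) := by
  simp only [Finset.mem_Icc] at ha hb hc hd
  have hK2' : K + 3 ≤ n := by omega
  change IsFacetLe n K (pawMap a b c d) 2 ↔ _
  constructor
  · intro h
    obtain ⟨hab', hdc, hdb⟩ := lt_of_pawMap_le hK1 hK2' ha.1 hd.1 hb.1 hc.1 hb.2 hc.2 ha.2 hd.2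
      hab hac had hbc hbd hcd fun π => h.1 _ (charVec_mem_PolyP π)
    rcases lt_or_gt_of_ne hbc with hbc' | hcb
    · exact ⟨hdb hbc', hbc', hab'⟩
    · exact absurd h (not_isFacetLe_paw hK1 hK2' ha.1 hd.1 had hac hc.1 hab' hdc hcb hb.2)
  · rintro ⟨hdb, hbc', hab'⟩
    exact isFacetLe_paw hK1 hK2' ha.1 hd.1 had hb.1 hab' hdb hbc' hc.2
end

section
/- Let n ≥ 6 and 3 ≤ K ≤ n−3, and let a, c, d be pairwise distinct vertices of V ∖ {3} with c ∈ {4,…,n}. The inequality x_{a,3} + x_{3,c} − x_{a,c} + x_{c,d} + x_c + x_{1,2} − Σ_{i=4}^{n} x_i ≤ 4 − K (the paw inequality for b = 3 written in the variables of P_{n,K}) is facet-defining for P_{n,K} if and only if d < 3 and a < 3. -/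
open Finset

theorem adim_face_add_one {V : Set GPoint} (hV : V.Finite) (L : GPoint →ₗ[ℝ] ℝ) (b : ℝ)
    {p q : GPoint} (hp : p ∈ V) (hpb : L p = b) (hq : q ∈ V) (hqb : L q ≠ b)
    (key : ∀ (g : GPoint →ₗ[ℝ] ℝ) (t : ℝ), (∀ x ∈ V, L x = b → g x = t) →
      ∃ l t' : ℝ, ∀ x ∈ V, g x = l * L x + t') :
    adim {x | x ∈ convexHull ℝ V ∧ L x = b} + 1 = adim (convexHull ℝ V) := by
  unfold adim
  rw [affineSpan_convexHull, direction_affineSpan, direction_affineSpan]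
  set F : Set GPoint := {x | x ∈ convexHull ℝ V ∧ L x = b} with hF
  have hpF : p ∈ F := ⟨subset_convexHull ℝ V hp, hpb⟩
  have hFP : vectorSpan ℝ F ≤ vectorSpan ℝ V := by
    rw [← direction_affineSpan ℝ V, ← affineSpan_convexHull, direction_affineSpan]
    exact vectorSpan_mono ℝ fun x hx => hx.1
  have hFL : vectorSpan ℝ F ≤ LinearMap.ker L := by
    rw [vectorSpan_def, Submodule.span_le]
    rintro _ ⟨x, hx, y, hy, rfl⟩
    simp [hx.2, hy.2]
  have hEq : vectorSpan ℝ F = LinearMap.ker L ⊓ vectorSpan ℝ V := by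
    refine le_antisymm (le_inf hFL hFP) fun x hx => ?_
    by_contra hxF
    obtain ⟨g, hg0, hgF⟩ := Submodule.exists_le_ker_of_notMem hxF
    obtain ⟨l, t', hl⟩ := key g (g p) fun y hy hyb => by
      have h1 : y -ᵥ p ∈ vectorSpan ℝ F :=
        vsub_mem_vectorSpan ℝ ⟨subset_convexHull ℝ V hy, hyb⟩ hpF
      have h2 := hgF h1
      simpa [sub_eq_zero] using h2
    have h3 : vectorSpan ℝ V ≤ LinearMap.ker (g - l • L) := by
      rw [vectorSpan_def, Submodule.span_le]
      rintro _ ⟨y, hy, z, hz, rfl⟩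
      simp only [vsub_eq_sub, SetLike.mem_coe, LinearMap.mem_ker, LinearMap.sub_apply,
        LinearMap.smul_apply, map_sub, smul_eq_mul, hl y hy, hl z hz]
      ring
    have h4 := h3 hx.2
    have h5 : L x = 0 := hx.1
    simp [h5] at h4
    exact hg0 h4
  have hfd : FiniteDimensional ℝ (vectorSpan ℝ V) := finiteDimensional_vectorSpan_of_finite ℝ hV
  have hrn := LinearMap.finrank_range_add_finrank_ker (L.domRestrict (vectorSpan ℝ V))
  have hker : Module.finrank ℝ (LinearMap.ker (L.domRestrict (vectorSpan ℝ V))) =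
      Module.finrank ℝ (vectorSpan ℝ F) := by
    rw [hEq, LinearMap.ker_domRestrict, inf_comm]
    exact (Submodule.equivSubtypeMap _ _).finrank_eq.trans
      (by rw [Submodule.map_comap_subtype])
  have hrange : LinearMap.range (L.domRestrict (vectorSpan ℝ V)) = ⊤ := by
    rw [LinearMap.range_eq_top]
    refine LinearMap.surjective fun h => ?_
    have h1 := LinearMap.congr_fun h ⟨q -ᵥ p, vsub_mem_vectorSpan ℝ hq hp⟩
    simp [sub_eq_zero, hpb] at h1
    exact hqb h1
  rw [hrange, finrank_top, Module.finrank_self, hker] at hrn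
  exact (add_comm _ _).trans hrn

/-- `σ` sends every vertex of `{1,…,n}` to the smallest element of its cluster in some
`K`-partition. -/
structure IsRepMap (n K : ℕ) (σ : ℕ → ℕ) : Prop where
  pos : ∀ v ∈ Icc 1 n, 1 ≤ σ v
  le : ∀ v ∈ Icc 1 n, σ v ≤ v
  idem : ∀ v ∈ Icc 1 n, σ (σ v) = σ v
  card : #{v ∈ Icc 1 n | σ v = v} = K

/-- The characteristic vector of the partition of `{1,…,n}` into the fibers of `σ`. -/
noncomputable def repVec (n : ℕ) (σ : ℕ → ℕ) : GPoint :=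
  ⟨fun p => if p.1 ∈ Icc 1 n ∧ p.2 ∈ Icc 1 n ∧ σ p.1 = σ p.2 then 1 else 0,
   fun v => if v ∈ Icc 4 n ∧ σ v = v then 1 else 0⟩

theorem IsRepMap.mem {n K : ℕ} {σ : ℕ → ℕ} (h : IsRepMap n K σ) {v : ℕ} (hv : v ∈ Icc 1 n) :
    σ v ∈ Icc 1 n :=
  mem_Icc.2 ⟨h.pos v hv, (h.le v hv).trans (mem_Icc.1 hv).2⟩

theorem KPartition.exists_mem_s15 {n K : ℕ} (π : KPartition n K) {v : ℕ} :
    v ∈ Icc 1 n ↔ ∃ C ∈ π.parts, v ∈ C := by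
  rw [← π.parts_cover, Finset.mem_sup]
  rfl

theorem KPartition.eq_of_mem_s15 {n K : ℕ} (π : KPartition n K) {v : ℕ} {C D : Finset ℕ}
    (hC : C ∈ π.parts) (hD : D ∈ π.parts) (hvC : v ∈ C) (hvD : v ∈ D) : C = D := by
  by_contra h
  exact Finset.disjoint_left.1 (π.parts_disjoint C hC D hD h) hvC hvD

theorem charVec_eq_repVec {n K : ℕ} (π : KPartition n K) {σ : ℕ → ℕ}
    (hσ : ∀ C ∈ π.parts, ∀ v ∈ C, σ v ∈ C ∧ ∀ u ∈ C, σ v ≤ u) :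
    charVec n K π = repVec n σ := by
  have hmem := fun v => π.exists_mem_s15 (v := v)
  refine Prod.ext (funext fun p => ?_) (funext fun v => ?_)
  · refine if_congr ⟨?_, ?_⟩ rfl rfl
    · rintro ⟨C, hC, h1, h2⟩
      exact ⟨(hmem _).2 ⟨C, hC, h1⟩, (hmem _).2 ⟨C, hC, h2⟩,
        le_antisymm ((hσ C hC _ h1).2 _ (hσ C hC _ h2).1)
          ((hσ C hC _ h2).2 _ (hσ C hC _ h1).1)⟩
    · rintro ⟨h1, h2, h⟩
      obtain ⟨C, hC, hC1⟩ := (hmem _).1 h1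
      obtain ⟨D, hD, hD2⟩ := (hmem _).1 h2
      obtain rfl := π.eq_of_mem_s15 hC hD (hσ C hC _ hC1).1 (h ▸ (hσ D hD _ hD2).1)
      exact ⟨C, hC, hC1, hD2⟩
  · refine if_congr ⟨?_, ?_⟩ rfl rfl
    · rintro ⟨h4, C, hC, hv, h⟩
      have h1 := mem_Icc.1 ((hmem v).2 ⟨C, hC, hv⟩)
      exact ⟨mem_Icc.2 ⟨h4, h1.2⟩,
        le_antisymm ((hσ C hC v hv).2 v hv) (h _ (hσ C hC v hv).1)⟩
    · rintro ⟨hv, h⟩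
      have h1 := mem_Icc.1 hv
      obtain ⟨C, hC, hvC⟩ := (hmem v).1 (mem_Icc.2 ⟨by omega, h1.2⟩)
      exact ⟨h1.1, C, hC, hvC, fun w hw => h ▸ (hσ C hC v hvC).2 w hw⟩

theorem exists_isRepMap {n K : ℕ} (π : KPartition n K) :
    ∃ σ, IsRepMap n K σ ∧ charVec n K π = repVec n σ := by
  set σ : ℕ → ℕ := fun v => sInf {u | ∃ C ∈ π.parts, v ∈ C ∧ u ∈ C} with hdef
  have hσ : ∀ C ∈ π.parts, ∀ v ∈ C, σ v ∈ C ∧ ∀ u ∈ C, σ v ≤ u := by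
    intro C hC v hv
    refine ⟨?_, fun u hu => Nat.sInf_le ⟨C, hC, hv, hu⟩⟩
    have hne : {u | ∃ C ∈ π.parts, v ∈ C ∧ u ∈ C}.Nonempty := ⟨v, C, hC, hv, hv⟩
    obtain ⟨D, hD, hvD, h⟩ := Nat.sInf_mem hne
    rwa [π.eq_of_mem_s15 hC hD hv hvD]
  refine ⟨σ, ⟨fun v hv => ?_, fun v hv => ?_, fun v hv => ?_, ?_⟩, charVec_eq_repVec π hσ⟩
  · obtain ⟨C, hC, hv⟩ := π.exists_mem_s15.1 hv
    exact (mem_Icc.1 (π.exists_mem_s15.2 ⟨C, hC, (hσ C hC v hv).1⟩)).1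
  · obtain ⟨C, hC, hv⟩ := π.exists_mem_s15.1 hv
    exact (hσ C hC v hv).2 v hv
  · obtain ⟨C, hC, hv⟩ := π.exists_mem_s15.1 hv
    have h := hσ C hC v hv
    have h' := hσ C hC _ h.1
    exact le_antisymm (h'.2 _ h.1) (h.2 _ h'.1)
  · rw [← π.card_parts]
    choose! C hC hvC using fun v (hv : v ∈ Icc 1 n) => π.exists_mem_s15.1 hv
    refine Finset.card_bij (fun v _ => C v) ?_ ?_ ?_
    · intro v hv
      exact hC v (mem_filter.1 hv).1
    · intro u hu v hv huv
      rw [mem_filter] at hu hv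
      have h1 := hσ _ (hC u hu.1) u (hvC u hu.1)
      have h2 := hσ _ (hC v hv.1) v (hvC v hv.1)
      rw [hu.2] at h1
      rw [hv.2] at h2
      exact le_antisymm (h1.2 v (huv ▸ h2.1)) (h2.2 u (huv ▸ h1.1))
    · intro D hD
      obtain ⟨v, hv⟩ := π.parts_nonempty D hD
      have h := hσ D hD v hv
      have h' := hσ D hD _ h.1
      have hm := π.exists_mem_s15.2 ⟨D, hD, h.1⟩
      exact ⟨σ v, mem_filter.2 ⟨hm, le_antisymm (h'.2 _ h.1) (h.2 _ h'.1)⟩,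
        π.eq_of_mem_s15 (hC _ hm) hD (hvC _ hm) h.1⟩

theorem IsRepMap.exists_kPartition {n K : ℕ} {σ : ℕ → ℕ} (h : IsRepMap n K σ) :
    ∃ π : KPartition n K, repVec n σ = charVec n K π := by
  let fib : ℕ → Finset ℕ := fun r => {u ∈ Icc 1 n | σ u = r}
  have hself : ∀ r ∈ ({v ∈ Icc 1 n | σ v = v} : Finset ℕ), r ∈ fib r :=
    fun r hr => mem_filter.2 ⟨(mem_filter.1 hr).1, (mem_filter.1 hr).2⟩
  let π : KPartition n K :=
    { parts := ({v ∈ Icc 1 n | σ v = v} : Finset ℕ).image fib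
      card_parts := by
        rw [Finset.card_image_of_injOn, h.card]
        intro r hr s hs hrs
        have h1 : r ∈ fib s := by
          have := hself r hr
          rwa [show fib r = fib s from hrs] at this
        exact (mem_filter.1 hr).2.symm.trans (mem_filter.1 h1).2
      parts_nonempty := by
        intro C hC
        obtain ⟨r, hr, rfl⟩ := mem_image.1 hC
        exact ⟨r, hself r hr⟩
      parts_disjoint := by
        intro C hC D hD hCD
        obtain ⟨r, hr, rfl⟩ := mem_image.1 hC
        obtain ⟨s, hs, rfl⟩ := mem_image.1 hD
        refine Finset.disjoint_left.2 fun u hu hu' => hCD ?_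
        rw [← (mem_filter.1 hu).2, ← (mem_filter.1 hu').2]
      parts_cover := by
        ext v
        rw [Finset.mem_sup]
        constructor
        · rintro ⟨C, hC, hv⟩
          obtain ⟨r, hr, rfl⟩ := mem_image.1 hC
          exact (mem_filter.1 hv).1
        · intro hv
          exact ⟨fib (σ v), mem_image.2 ⟨σ v, mem_filter.2 ⟨h.mem hv, h.idem v hv⟩, rfl⟩,
            mem_filter.2 ⟨hv, rfl⟩⟩ }
  refine ⟨π, (charVec_eq_repVec π fun C hC v hv => ?_).symm⟩
  obtain ⟨r, hr, rfl⟩ := mem_image.1 hC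
  rw [mem_filter] at hv
  have hr' := mem_filter.1 hr
  refine ⟨by rw [hv.2]; exact hself r hr, fun u hu => ?_⟩
  rw [mem_filter] at hu
  rw [hv.2, ← hu.2]
  exact h.le u hu.1

theorem setOf_charVec_eq (n K : ℕ) :
    {x | ∃ π : KPartition n K, x = charVec n K π} = {x | ∃ σ, IsRepMap n K σ ∧ x = repVec n σ} := by
  ext x
  constructor
  · rintro ⟨π, rfl⟩
    exact exists_isRepMap π
  · rintro ⟨σ, hσ, rfl⟩
    exact hσ.exists_kPartition

theorem finite_setOf_charVec (n K : ℕ) : {x | ∃ π : KPartition n K, x = charVec n K π}.Finite := by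
  have hinj : Function.Injective (KPartition.parts : KPartition n K → Finset (Finset ℕ)) := by
    rintro ⟨⟩ ⟨⟩ h
    congr
  have : Finite (KPartition n K) := by
    refine Finite.of_injective
      (fun π : KPartition n K =>
        (⟨π.parts, ?_⟩ : {P : Finset (Finset ℕ) // P ∈ (Icc 1 n).powerset.powerset})) ?_
    · rw [mem_powerset]
      intro C hC
      rw [mem_powerset]
      exact fun v hv => π.exists_mem_s15.2 ⟨C, hC, hv⟩
    · intro π ρ h
      exact hinj (congrArg Subtype.val h)
  refine (Set.finite_range (charVec n K)).subset ?_
  rintro x ⟨π, rfl⟩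
  exact ⟨π, rfl⟩

/-- The left-hand side of the paw inequality for `b = 3` as a linear form. -/
noncomputable def pawForm (n a c d : ℕ) : GPoint →ₗ[ℝ] ℝ where
  toFun x := x.1 (a, 3) + x.1 (3, c) - x.1 (a, c) + x.1 (c, d) + x.2 c + x.1 (1, 2) -
    ∑ i ∈ Icc 4 n, x.2 i
  map_add' x y := by
    simp only [Prod.fst_add, Prod.snd_add, Pi.add_apply, sum_add_distrib]
    ring
  map_smul' t x := by
    simp only [Prod.smul_fst, Prod.smul_snd, Pi.smul_apply, smul_eq_mul, ← mul_sum,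
      RingHom.id_apply]
    ring

/-- The indicator of a proposition, as a real number. -/
noncomputable abbrev ind (p : Prop) [Decidable p] : ℝ := if p then 1 else 0

theorem ind_pos {p : Prop} [Decidable p] (h : p) : ind p = 1 := if_pos h

theorem ind_neg {p : Prop} [Decidable p] (h : ¬p) : ind p = 0 := if_neg h

theorem sum_Icc_eq {n c : ℕ} (hc : c ∈ Icc 4 n) (F : ℕ → ℝ) :
    ∑ v ∈ Icc 1 n, F v = F 1 + F 2 + F 3 + F c + ∑ v ∈ (Icc 4 n).erase c, F v := by
  have h := mem_Icc.1 hc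
  have h1 : Icc 1 n = insert 1 (insert 2 (insert 3 (Icc 4 n))) := by
    ext v
    simp only [mem_insert, mem_Icc]
    omega
  rw [h1, sum_insert (by simp), sum_insert (by simp), sum_insert (by simp),
    ← add_sum_erase _ _ hc]
  ring

theorem pawForm_repVec {n a c d : ℕ} (σ : ℕ → ℕ) (ha : a ∈ Icc 1 n) (hc : c ∈ Icc 4 n)
    (hd : d ∈ Icc 1 n) :
    pawForm n a c d (repVec n σ) = ind (σ a = σ 3) + ind (σ 3 = σ c) - ind (σ a = σ c) +
      ind (σ c = σ d) + ind (σ 1 = σ 2) - ∑ i ∈ (Icc 4 n).erase c, ind (σ i = i) := by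
  have h := mem_Icc.1 hc
  have hc1 : c ∈ Icc 1 n := mem_Icc.2 (by omega)
  have h1 : 1 ∈ Icc 1 n := mem_Icc.2 (by omega)
  have h2 : 2 ∈ Icc 1 n := mem_Icc.2 (by omega)
  have h3 : 3 ∈ Icc 1 n := mem_Icc.2 (by omega)
  have hs : ∑ i ∈ Icc 4 n, (repVec n σ).2 i = ∑ i ∈ Icc 4 n, ind (σ i = i) :=
    sum_congr rfl fun i hi => if_congr (and_iff_right hi) rfl rfl
  change (repVec n σ).1 (a, 3) + (repVec n σ).1 (3, c) - (repVec n σ).1 (a, c) +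
    (repVec n σ).1 (c, d) + (repVec n σ).2 c + (repVec n σ).1 (1, 2) -
    ∑ i ∈ Icc 4 n, (repVec n σ).2 i = _
  rw [hs, ← add_sum_erase _ _ hc]
  simp only [repVec, ha, hc, hd, hc1, h1, h2, h3, true_and]
  ring

theorem IsRepMap.sum_ind {n K c : ℕ} {σ : ℕ → ℕ} (h : IsRepMap n K σ) (hc : c ∈ Icc 4 n) :
    ind (σ 1 = 1) + ind (σ 2 = 2) + ind (σ 3 = 3) + ind (σ c = c) +
      ∑ i ∈ (Icc 4 n).erase c, ind (σ i = i) = K := by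
  rw [← sum_Icc_eq hc fun v => ind (σ v = v), ← h.card, sum_boole]

theorem paw_ind_le {c i₂ i₃ j A D : ℕ} (hc : 4 ≤ c) (e2 : i₂ = 1 ∨ i₂ = 2)
    (e3 : i₃ = 1 ∨ i₃ = 2 ∧ i₂ = 2 ∨ i₃ = 3)
    (ej : j = 1 ∨ j = 2 ∧ i₂ = 2 ∨ j = 3 ∧ i₃ = 3 ∨ 4 ≤ j)
    (eA : A = 1 ∧ D = i₂ ∨ A = i₂ ∧ D = 1) :
    ind (A = i₃) + ind (i₃ = j) - ind (A = j) + ind (j = D) + ind (1 = i₂) +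
      ind (i₂ = 2) + ind (i₃ = 3) + ind (j = c) ≤ 3 := by
  have c1 : 1 ≠ c := by omega
  have c2 : 2 ≠ c := by omega
  have c3 : 3 ≠ c := by omega
  rcases e2 with rfl | rfl <;> rcases e3 with rfl | ⟨rfl, h⟩ | rfl <;>
    rcases ej with rfl | ⟨rfl, h'⟩ | ⟨rfl, h'⟩ | h' <;> try omega
  all_goals first
    | have j1 : j ≠ 1 := by omega
      have j2 : j ≠ 2 := by omega
      have j3 : j ≠ 3 := by omega
      rcases eA with ⟨rfl, rfl⟩ | ⟨rfl, rfl⟩ <;>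
        norm_num [ind, j1, j2, j3, j1.symm, j2.symm, j3.symm] <;> split_ifs <;> norm_num
    | rcases eA with ⟨rfl, rfl⟩ | ⟨rfl, rfl⟩ <;>
        simp only [ind, c1, c2, c3] <;> norm_num

theorem pawForm_repVec_le {n K a c d : ℕ} {σ : ℕ → ℕ} (h : IsRepMap n K σ) (hc : c ∈ Icc 4 n)
    (had : a = 1 ∧ d = 2 ∨ a = 2 ∧ d = 1) : pawForm n a c d (repVec n σ) ≤ 4 - K := by
  have hc' := mem_Icc.1 hc
  have h1 : 1 ∈ Icc 1 n := mem_Icc.2 (by omega)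
  have h2 : 2 ∈ Icc 1 n := mem_Icc.2 (by omega)
  have h3 : 3 ∈ Icc 1 n := mem_Icc.2 (by omega)
  have hcI : c ∈ Icc 1 n := mem_Icc.2 (by omega)
  have ha : a ∈ Icc 1 n := mem_Icc.2 (by omega)
  have hd : d ∈ Icc 1 n := mem_Icc.2 (by omega)
  rw [pawForm_repVec σ ha hc hd]
  have hs := h.sum_ind hc
  have e1 : σ 1 = 1 := le_antisymm (h.le 1 h1) (h.pos 1 h1)
  have e2 : σ 2 = 1 ∨ σ 2 = 2 := by have := h.le 2 h2; have := h.pos 2 h2; omega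
  have e3 : σ 3 = 1 ∨ σ 3 = 2 ∨ σ 3 = 3 := by have := h.le 3 h3; have := h.pos 3 h3; omega
  have i3 := h.idem 3 h3
  have ic := h.idem c hcI
  have hcpos := h.pos c hcI
  rw [← hs, e1]
  have eA : σ a = 1 ∧ σ d = σ 2 ∨ σ a = σ 2 ∧ σ d = 1 := by
    rcases had with ⟨rfl, rfl⟩ | ⟨rfl, rfl⟩ <;> simp [e1]
  have e3' : σ 3 = 1 ∨ σ 3 = 2 ∧ σ 2 = 2 ∨ σ 3 = 3 := by
    rcases e3 with e3 | e3 | e3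
    · exact .inl e3
    · exact .inr (.inl ⟨e3, by rwa [e3] at i3⟩)
    · exact .inr (.inr e3)
  have ej : σ c = 1 ∨ σ c = 2 ∧ σ 2 = 2 ∨ σ c = 3 ∧ σ 3 = 3 ∨ 4 ≤ σ c := by
    rcases (by omega : σ c = 1 ∨ σ c = 2 ∨ σ c = 3 ∨ 4 ≤ σ c) with e | e | e | e
    · exact .inl e
    · exact .inr (.inl ⟨e, by rwa [e] at ic⟩)
    · exact .inr (.inr (.inl ⟨e, by rwa [e] at ic⟩))
    · exact .inr (.inr (.inr e))
  have := paw_ind_le hc'.1 e2 e3' ej eA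
  rw [ind_pos (rfl : 1 = 1)]
  linarith

/-- A map with prescribed values `i₂`, `i₃`, `j` at `2`, `3`, `c`, the elements of `S` as
fixed points, and `ρ` elsewhere. -/
def stdMap (c i₂ i₃ j : ℕ) (S : Finset ℕ) (ρ : ℕ → ℕ) (v : ℕ) : ℕ :=
  if v = 1 then 1 else if v = 2 then i₂ else if v = 3 then i₃ else if v = c then j
  else if v ∈ S then v else ρ v

/-- `x` is one of the fixed points among `1, 2, 3` of a `stdMap` with values `i₂`, `i₃`. -/
def IsSmallRep (i₂ i₃ x : ℕ) : Prop := x = 1 ∨ x = 2 ∧ i₂ = 2 ∨ x = 3 ∧ i₃ = 3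

/-- Conditions on the data of `stdMap` making it a representative map of a `K`-partition. -/
structure IsStd (n K c i₂ i₃ j : ℕ) (S : Finset ℕ) (ρ : ℕ → ℕ) : Prop where
  two : i₂ = 1 ∨ i₂ = 2
  three : i₃ = 1 ∨ i₃ = 2 ∧ i₂ = 2 ∨ i₃ = 3
  val : IsSmallRep i₂ i₃ j ∨ j = c
  rest : ∀ v, IsSmallRep i₂ i₃ (ρ v)
  subset : S ⊆ (Icc 4 n).erase c
  card : (1 + if i₂ = 2 then 1 else 0) + (if i₃ = 3 then 1 else 0) + (if j = c then 1 else 0) +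
    #S = K

section stdMap

variable {n K c i₂ i₃ j : ℕ} {S : Finset ℕ} {ρ : ℕ → ℕ}

theorem stdMap_one : stdMap c i₂ i₃ j S ρ 1 = 1 := rfl

theorem stdMap_two : stdMap c i₂ i₃ j S ρ 2 = i₂ := rfl

theorem stdMap_three : stdMap c i₂ i₃ j S ρ 3 = i₃ := rfl

theorem stdMap_self (hc : c ∈ Icc 4 n) : stdMap c i₂ i₃ j S ρ c = j := by
  have := mem_Icc.1 hc
  simp [stdMap, show c ≠ 1 by omega, show c ≠ 2 by omega, show c ≠ 3 by omega]

theorem stdMap_rest {v : ℕ} (hv : v ∈ (Icc 4 n).erase c) :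
    stdMap c i₂ i₃ j S ρ v = if v ∈ S then v else ρ v := by
  have h := mem_erase.1 hv
  have := mem_Icc.1 h.2
  simp [stdMap, show v ≠ 1 by omega, show v ≠ 2 by omega, show v ≠ 3 by omega, h.1]

theorem stdMap_smallRep {x : ℕ} (hx : IsSmallRep i₂ i₃ x) : stdMap c i₂ i₃ j S ρ x = x := by
  rcases hx with rfl | ⟨rfl, h⟩ | ⟨rfl, h⟩
  · rfl
  · exact h
  · exact h

theorem IsSmallRep.pos {x : ℕ} (hx : IsSmallRep i₂ i₃ x) : 1 ≤ x := by
  rcases hx with rfl | ⟨rfl, h⟩ | ⟨rfl, h⟩ <;> omega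

theorem IsSmallRep.le {x : ℕ} (hx : IsSmallRep i₂ i₃ x) : x ≤ 3 := by
  rcases hx with rfl | ⟨rfl, h⟩ | ⟨rfl, h⟩ <;> omega

theorem IsStd.stdMap_ne (h : IsStd n K c i₂ i₃ j S ρ) {v : ℕ} (hv : v ∈ (Icc 4 n).erase c)
    (hS : v ∉ S) : stdMap c i₂ i₃ j S ρ v ≠ v := by
  have h1 := mem_Icc.1 (mem_erase.1 hv).2
  have h2 := (h.rest v).le
  rw [stdMap_rest hv, if_neg hS]
  omega

theorem IsStd.sum_rest (h : IsStd n K c i₂ i₃ j S ρ) (r : ℕ → ℝ) :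
    ∑ v ∈ (Icc 4 n).erase c, r v * ind (stdMap c i₂ i₃ j S ρ v = v) = ∑ v ∈ S, r v := by
  rw [← sum_subset h.subset fun v hv hS => by rw [ind_neg (h.stdMap_ne hv hS), mul_zero]]
  exact sum_congr rfl fun v hv => by
    rw [ind_pos (by rw [stdMap_rest (h.subset hv), if_pos hv]), mul_one]

theorem IsStd.isRepMap (h : IsStd n K c i₂ i₃ j S ρ) (hc : c ∈ Icc 4 n) :
    IsRepMap n K (stdMap c i₂ i₃ j S ρ) := by
  have hc' := mem_Icc.1 hc
  have h2 : IsSmallRep i₂ i₃ i₂ := by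
    rcases h.two with e | e
    · exact .inl e
    · exact .inr (.inl ⟨e, e⟩)
  have h3 : IsSmallRep i₂ i₃ i₃ := by
    rcases h.three with e | e | e
    · exact .inl e
    · exact .inr (.inl e)
    · exact .inr (.inr ⟨e, e⟩)
  have i2le : i₂ ≤ 2 := by rcases h.two with e | e <;> omega
  have all : ∀ v ∈ Icc 1 n, stdMap c i₂ i₃ j S ρ v = v ∨
      stdMap c i₂ i₃ j S ρ v ≤ v ∧ IsSmallRep i₂ i₃ (stdMap c i₂ i₃ j S ρ v) := by
    intro v hv
    have hv' := mem_Icc.1 hv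
    by_cases e1 : v = 1
    · subst e1; exact .inl rfl
    by_cases e2 : v = 2
    · subst e2; exact .inr ⟨i2le, h2⟩
    by_cases e3 : v = 3
    · subst e3; exact .inr ⟨h3.le, h3⟩
    by_cases ec : v = c
    · subst ec
      rw [stdMap_self hc]
      exact h.val.symm.imp_right fun hj => ⟨hj.le.trans (by omega), hj⟩
    have hvW : v ∈ (Icc 4 n).erase c := mem_erase.2 ⟨ec, mem_Icc.2 (by omega)⟩
    rw [stdMap_rest hvW]
    split_ifs with hS
    · exact .inl rfl
    · exact .inr ⟨(h.rest v).le.trans (by omega), h.rest v⟩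
  refine ⟨fun v hv => ?_, fun v hv => ?_, fun v hv => ?_, ?_⟩
  · rcases all v hv with e | ⟨-, e⟩
    · rw [e]; exact (mem_Icc.1 hv).1
    · exact e.pos
  · rcases all v hv with e | ⟨e, -⟩
    · exact e.le
    · exact e
  · rcases all v hv with e | ⟨-, e⟩
    · rw [e, e]
    · exact stdMap_smallRep e
  · have hs := h.sum_rest fun _ => 1
    simp only [one_mul, sum_const, nsmul_eq_mul, mul_one] at hs
    have hK := h.card
    have key : ((#{v ∈ Icc 1 n | stdMap c i₂ i₃ j S ρ v = v} : ℕ) : ℝ) = (K : ℕ) := by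
      rw [← sum_boole, sum_Icc_eq hc, hs, stdMap_one, stdMap_two, stdMap_three, stdMap_self hc,
        ← hK]
      push_cast
      simp
    exact_mod_cast key

theorem IsStd.pawForm_eq {a d : ℕ} (h : IsStd n K c i₂ i₃ j S ρ) (hc : c ∈ Icc 4 n)
    (ha : a ∈ Icc 1 n) (hd : d ∈ Icc 1 n) {A D : ℕ} (hA : stdMap c i₂ i₃ j S ρ a = A)
    (hD : stdMap c i₂ i₃ j S ρ d = D) :
    pawForm n a c d (repVec n (stdMap c i₂ i₃ j S ρ)) =
      ind (A = i₃) + ind (i₃ = j) - ind (A = j) + ind (j = D) + ind (1 = i₂) +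
        ind (i₂ = 2) + ind (i₃ = 3) + ind (j = c) + 1 - K := by
  have hs := h.sum_rest fun _ => 1
  simp only [one_mul, sum_const, nsmul_eq_mul, mul_one] at hs
  rw [pawForm_repVec _ ha hc hd, hs, hA, hD, stdMap_one, stdMap_two, stdMap_three,
    stdMap_self hc, ← h.card]
  push_cast
  ring

end stdMap

/-- A quadratic function of a representative map: the value of a linear form on its
characteristic vector. -/
noncomputable def quad (n : ℕ) (M : ℕ → ℕ → ℝ) (r : ℕ → ℝ) (σ : ℕ → ℕ) : ℝ :=
  ∑ u ∈ Icc 1 n, ∑ v ∈ Icc 1 n, M u v * ind (σ u = σ v) + ∑ v ∈ Icc 4 n, r v * ind (σ v = v)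

theorem repVec_eq_sum (n : ℕ) (σ : ℕ → ℕ) :
    repVec n σ = ∑ u ∈ Icc 1 n, ∑ v ∈ Icc 1 n,
        ind (σ u = σ v) • ((Pi.single (u, v) 1, 0) : GPoint) +
      ∑ v ∈ Icc 4 n, ind (σ v = v) • ((0, Pi.single v 1) : GPoint) := by
  rw [← sum_product']
  refine Prod.ext (funext fun p => ?_) (funext fun v => ?_)
  · simp only [repVec, Prod.fst_add, Prod.fst_sum, Prod.smul_fst, Pi.add_apply, Finset.sum_apply,
      Pi.smul_apply, Pi.single_apply, smul_eq_mul, Pi.zero_apply, mul_zero, sum_const_zero,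
      add_zero, mul_ite, mul_one, Prod.mk.eta, sum_ite_eq, mem_product]
    unfold ind
    split_ifs <;> tauto
  · simp only [repVec, Prod.snd_add, Prod.snd_sum, Prod.smul_snd, Pi.add_apply, Finset.sum_apply,
      Pi.smul_apply, Pi.single_apply, smul_eq_mul, Pi.zero_apply, mul_zero, sum_const_zero,
      zero_add, mul_ite, mul_one, sum_ite_eq]
    unfold ind
    split_ifs <;> tauto

theorem exists_quad (n : ℕ) (g : GPoint →ₗ[ℝ] ℝ) :
    ∃ (M : ℕ → ℕ → ℝ) (r : ℕ → ℝ), (∀ u v, M u v = M v u) ∧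
      ∀ σ, g (repVec n σ) = quad n M r σ := by
  set q : ℕ → ℕ → ℝ := fun u v => g (Pi.single (u, v) 1, 0)
  refine ⟨fun u v => (q u v + q v u) / 2, fun v => g (0, Pi.single v 1),
    fun u v => by ring, fun σ => ?_⟩
  have h1 : g (repVec n σ) = ∑ u ∈ Icc 1 n, ∑ v ∈ Icc 1 n, q u v * ind (σ u = σ v) +
      ∑ v ∈ Icc 4 n, g (0, Pi.single v 1) * ind (σ v = v) := by
    rw [repVec_eq_sum]
    simp only [map_add, map_sum, map_smul, smul_eq_mul, mul_comm, q]
  have h2 : ∑ u ∈ Icc 1 n, ∑ v ∈ Icc 1 n, q u v * ind (σ u = σ v) =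
      ∑ u ∈ Icc 1 n, ∑ v ∈ Icc 1 n, q v u * ind (σ u = σ v) := by
    rw [sum_comm]
    simp only [eq_comm]
  have h3 : ∑ u ∈ Icc 1 n, ∑ v ∈ Icc 1 n, (q u v + q v u) / 2 * ind (σ u = σ v) =
      (∑ u ∈ Icc 1 n, ∑ v ∈ Icc 1 n, q u v * ind (σ u = σ v) +
        ∑ u ∈ Icc 1 n, ∑ v ∈ Icc 1 n, q v u * ind (σ u = σ v)) / 2 := by
    simp only [← sum_add_distrib, sum_div]
    exact sum_congr rfl fun u _ => sum_congr rfl fun v _ => by ring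
  rw [h1, quad, h3, ← h2]
  ring

theorem quad_sub_quad {n w : ℕ} {M : ℕ → ℕ → ℝ} (hM : ∀ u v, M u v = M v u) (r : ℕ → ℝ)
    {σ τ : ℕ → ℕ} (hw : w ∈ Icc 1 n) (hστ : ∀ v ∈ Icc 1 n, v ≠ w → σ v = τ v)
    (hσw : σ w ≠ w) (hτw : τ w ≠ w) :
    quad n M r σ - quad n M r τ =
      2 * ∑ v ∈ (Icc 1 n).erase w, M w v * (ind (σ w = σ v) - ind (τ w = σ v)) := by
  have hlin : ∑ v ∈ Icc 4 n, r v * ind (σ v = v) = ∑ v ∈ Icc 4 n, r v * ind (τ v = v) := by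
    refine sum_congr rfl fun v hv => ?_
    have hv' := mem_Icc.1 hv
    by_cases e : v = w
    · subst e
      rw [ind_neg hσw, ind_neg hτw]
    · rw [hστ v (mem_Icc.2 (by omega)) e]
  have split : ∀ φ : ℕ → ℕ, ∑ u ∈ Icc 1 n, ∑ v ∈ Icc 1 n, M u v * ind (φ u = φ v) =
      M w w + 2 * ∑ v ∈ (Icc 1 n).erase w, M w v * ind (φ w = φ v) +
        ∑ u ∈ (Icc 1 n).erase w, ∑ v ∈ (Icc 1 n).erase w, M u v * ind (φ u = φ v) := by
    intro φ
    have e1 : ∀ u, ∑ v ∈ Icc 1 n, M u v * ind (φ u = φ v) =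
        M w u * ind (φ w = φ u) + ∑ v ∈ (Icc 1 n).erase w, M u v * ind (φ u = φ v) := by
      intro u
      rw [← add_sum_erase _ _ hw, hM u w]
      simp only [eq_comm]
    rw [← add_sum_erase _ _ hw, e1 w, ind_pos rfl]
    simp only [e1, sum_add_distrib]
    ring
  rw [quad, quad, hlin, split σ, split τ]
  have hrest : ∑ u ∈ (Icc 1 n).erase w, ∑ v ∈ (Icc 1 n).erase w, M u v * ind (σ u = σ v) =
      ∑ u ∈ (Icc 1 n).erase w, ∑ v ∈ (Icc 1 n).erase w, M u v * ind (τ u = τ v) := by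
    refine sum_congr rfl fun u hu => sum_congr rfl fun v hv => ?_
    rw [hστ u (mem_erase.1 hu).2 (mem_erase.1 hu).1, hστ v (mem_erase.1 hv).2 (mem_erase.1 hv).1]
  have hτ : ∑ v ∈ (Icc 1 n).erase w, M w v * ind (τ w = τ v) =
      ∑ v ∈ (Icc 1 n).erase w, M w v * ind (τ w = σ v) :=
    sum_congr rfl fun v hv => by rw [hστ v (mem_erase.1 hv).2 (mem_erase.1 hv).1]
  rw [hrest, hτ]
  simp only [mul_sub, sum_sub_distrib]
  ring

/-- The paw inequality is tight at a `stdMap` with values `i₂`, `i₃`, `j` at `2`, `3`, `c`. -/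
def IsTight (a d c i₂ i₃ j : ℕ) : Prop :=
  ind ((if a = 1 then 1 else i₂) = i₃) + ind (i₃ = j) - ind ((if a = 1 then 1 else i₂) = j) +
    ind (j = if d = 1 then 1 else i₂) + ind (1 = i₂) + ind (i₂ = 2) + ind (i₃ = 3) +
    ind (j = c) = 3

/-- `quad n M r` takes the value `t` at all representative maps of `K`-partitions for which
the paw inequality is tight. -/
structure TightConst (n K a c d : ℕ) (M : ℕ → ℕ → ℝ) (r : ℕ → ℝ) (t : ℝ) : Prop where
  mem : c ∈ Icc 4 n
  ends : a = 1 ∧ d = 2 ∨ a = 2 ∧ d = 1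
  symm : ∀ u v, M u v = M v u
  eq : ∀ σ, IsRepMap n K σ → pawForm n a c d (repVec n σ) = 4 - K → quad n M r σ = t

section coefficients

variable {n K a c d i₂ i₃ j : ℕ} {S : Finset ℕ} {ρ : ℕ → ℕ} {M : ℕ → ℕ → ℝ} {r : ℕ → ℝ} {t : ℝ}

theorem TightConst.quad_stdMap (H : TightConst n K a c d M r t) (ht : IsTight a d c i₂ i₃ j)
    (h : IsStd n K c i₂ i₃ j S ρ) : quad n M r (stdMap c i₂ i₃ j S ρ) = t := by
  have hc' := mem_Icc.1 H.mem
  have had := H.ends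
  refine H.eq _ (h.isRepMap H.mem) ?_
  have hval : ∀ e, e = 1 ∨ e = 2 → stdMap c i₂ i₃ j S ρ e = if e = 1 then 1 else i₂ := by
    rintro e (rfl | rfl) <;> rfl
  rw [h.pawForm_eq H.mem (mem_Icc.2 (by omega)) (mem_Icc.2 (by omega))
    (hval a (by omega)) (hval d (by omega))]
  unfold IsTight at ht
  linarith

theorem IsStd.update (h : IsStd n K c i₂ i₃ j S ρ) (w : ℕ) {x : ℕ} (hx : IsSmallRep i₂ i₃ x) :
    IsStd n K c i₂ i₃ j S (Function.update ρ w x) := by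
  refine ⟨h.two, h.three, h.val, fun v => ?_, h.subset, h.card⟩
  by_cases e : v = w
  · subst e
    rwa [Function.update_self]
  · rw [Function.update_of_ne e]
    exact h.rest v

theorem stdMap_update_of_ne {v w x : ℕ} (hv : v ≠ w) :
    stdMap c i₂ i₃ j S (Function.update ρ w x) v = stdMap c i₂ i₃ j S ρ v := by
  simp only [stdMap, Function.update_of_ne hv]

theorem stdMap_update_self {w x : ℕ} (hw : w ∈ (Icc 4 n).erase c) (hwS : w ∉ S) :
    stdMap c i₂ i₃ j S (Function.update ρ w x) w = x := by
  rw [stdMap_rest hw, if_neg hwS, Function.update_self]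

theorem TightConst.sum_erase_eq_zero (H : TightConst n K a c d M r t)
    (ht : IsTight a d c i₂ i₃ j) (h : IsStd n K c i₂ i₃ j S ρ) {w x y : ℕ}
    (hw : w ∈ (Icc 4 n).erase c) (hwS : w ∉ S) (hx : IsSmallRep i₂ i₃ x)
    (hy : IsSmallRep i₂ i₃ y) :
    ∑ v ∈ (Icc 1 n).erase w, M w v *
      (ind (x = stdMap c i₂ i₃ j S ρ v) - ind (y = stdMap c i₂ i₃ j S ρ v)) = 0 := by
  have hw' := mem_Icc.1 (mem_erase.1 hw).2
  have hX := H.quad_stdMap ht (h.update w hx)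
  have hY := H.quad_stdMap ht (h.update w hy)
  have hsub := quad_sub_quad (n := n) H.symm r (mem_Icc.2 (by omega))
    (fun v _ hv => by rw [stdMap_update_of_ne hv, stdMap_update_of_ne hv])
    ((h.update w hx).stdMap_ne hw hwS) ((h.update w hy).stdMap_ne hw hwS)
  rw [hX, hY, sub_self, stdMap_update_self hw hwS, stdMap_update_self hw hwS] at hsub
  have hcongr : ∑ v ∈ (Icc 1 n).erase w, M w v *
      (ind (x = stdMap c i₂ i₃ j S (Function.update ρ w x) v) -
        ind (y = stdMap c i₂ i₃ j S (Function.update ρ w x) v)) =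
      ∑ v ∈ (Icc 1 n).erase w, M w v *
        (ind (x = stdMap c i₂ i₃ j S ρ v) - ind (y = stdMap c i₂ i₃ j S ρ v)) :=
    sum_congr rfl fun v hv => by rw [stdMap_update_of_ne (mem_erase.1 hv).1]
  rw [hcongr] at hsub
  linarith

theorem card_Icc_erase (hc : c ∈ Icc 4 n) : #((Icc 4 n).erase c) = n - 4 := by
  rw [card_erase_of_mem hc, Nat.card_Icc]
  omega

theorem TightConst.coeff_eq_zero (H : TightConst n K a c d M r t) (hK1 : 3 ≤ K)
    (hK2 : K ≤ n - 3) {w w' : ℕ} (hw : w ∈ (Icc 4 n).erase c) (hw' : w' ∈ (Icc 4 n).erase c)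
    (hne : w ≠ w') : M w w' = 0 := by
  have hc := mem_Icc.1 H.mem
  have had := H.ends
  obtain ⟨S, hS, hScard⟩ : ∃ S ⊆ (((Icc 4 n).erase c).erase w).erase w', #S = K - 3 := by
    apply exists_subset_card_eq
    rw [card_erase_of_mem (mem_erase.2 ⟨hne.symm, hw'⟩), card_erase_of_mem hw,
      card_Icc_erase H.mem]
    omega
  have hS' := hS.trans (erase_subset _ _)
  have hwS : w ∉ S := fun h => (mem_erase.1 (hS' h)).1 rfl
  have hwS' : w' ∉ S := fun h => (mem_erase.1 (hS h)).1 rfl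
  have hstd : IsStd n K c 2 a c S fun _ => 1 := by
    refine ⟨by simp, by omega, .inr rfl, fun _ => .inl rfl, hS'.trans (erase_subset _ _), ?_⟩
    rw [if_pos rfl, if_neg (by omega), if_pos rfl]
    omega
  have ht : IsTight a d c 2 a c := by
    have c1 : 1 ≠ c := by omega
    have c2 : 2 ≠ c := by omega
    rcases had with ⟨rfl, rfl⟩ | ⟨rfl, rfl⟩ <;>
      norm_num [IsTight, ind, c1, c2, c1.symm, c2.symm]
  have h1 : IsSmallRep 2 a 1 := .inl rfl
  have h2 : IsSmallRep 2 a 2 := .inr (.inl ⟨rfl, rfl⟩)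
  have hw'I : w' ∈ (Icc 1 n).erase w := by
    have := mem_Icc.1 (mem_erase.1 hw').2
    exact mem_erase.2 ⟨hne.symm, mem_Icc.2 (by omega)⟩
  have e1 := H.sum_erase_eq_zero ht (hstd.update w' h1) hw hwS h1 h2
  have e2 := H.sum_erase_eq_zero ht (hstd.update w' h2) hw hwS h1 h2
  rw [← add_sum_erase _ _ hw'I, stdMap_update_self hw' hwS'] at e1 e2
  have hcongr : ∀ x, ∑ v ∈ ((Icc 1 n).erase w).erase w', M w v *
      (ind (1 = stdMap c 2 a c S (Function.update (fun _ => 1) w' x) v) -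
        ind (2 = stdMap c 2 a c S (Function.update (fun _ => 1) w' x) v)) =
      ∑ v ∈ ((Icc 1 n).erase w).erase w', M w v *
        (ind (1 = stdMap c 2 a c S (fun _ => 1) v) -
          ind (2 = stdMap c 2 a c S (fun _ => 1) v)) := fun x =>
    sum_congr rfl fun v hv => by rw [stdMap_update_of_ne (mem_erase.1 hv).1]
  rw [hcongr] at e1 e2
  norm_num [ind] at e1 e2
  linarith

theorem TightConst.move (H : TightConst n K a c d M r t) (hK1 : 3 ≤ K) (hK2 : K ≤ n - 3)
    (ht : IsTight a d c i₂ i₃ j) (two : i₂ = 1 ∨ i₂ = 2)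
    (three : i₃ = 1 ∨ i₃ = 2 ∧ i₂ = 2 ∨ i₃ = 3) (val : IsSmallRep i₂ i₃ j ∨ j = c) {k : ℕ}
    (hk : (1 + if i₂ = 2 then 1 else 0) + (if i₃ = 3 then 1 else 0) +
      (if j = c then 1 else 0) + k = K) (hkn : k ≤ n - 5) {w x y : ℕ}
    (hw : w ∈ (Icc 4 n).erase c) (hx : IsSmallRep i₂ i₃ x) (hy : IsSmallRep i₂ i₃ y) :
    M w 1 * (ind (x = 1) - ind (y = 1)) + M w 2 * (ind (x = i₂) - ind (y = i₂)) +
      M w 3 * (ind (x = i₃) - ind (y = i₃)) + M w c * (ind (x = j) - ind (y = j)) = 0 := by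
  obtain ⟨S, hS, hScard⟩ : ∃ S ⊆ ((Icc 4 n).erase c).erase w, #S = k := by
    apply exists_subset_card_eq
    rw [card_erase_of_mem hw, card_Icc_erase H.mem]
    omega
  have hwS : w ∉ S := fun h => (mem_erase.1 (hS h)).1 rfl
  have hstd : IsStd n K c i₂ i₃ j S fun _ => 1 :=
    ⟨two, three, val, fun _ => .inl rfl, hS.trans (erase_subset _ _), hScard ▸ hk⟩
  have e := H.sum_erase_eq_zero ht hstd hw hwS hx hy
  have hwI : w ∈ Icc 1 n := by
    have := mem_Icc.1 (mem_erase.1 hw).2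
    exact mem_Icc.2 (by omega)
  set F : ℕ → ℝ := fun v => M w v * (ind (x = stdMap c i₂ i₃ j S (fun _ => 1) v) -
    ind (y = stdMap c i₂ i₃ j S (fun _ => 1) v)) with hF
  have hsum := add_sum_erase _ F hwI
  rw [e, sum_Icc_eq H.mem, sum_eq_single_of_mem w hw fun v hv hvw => by
    simp only [hF, H.coeff_eq_zero hK1 hK2 hw hv hvw.symm, zero_mul]] at hsum
  have h0 : F 1 + F 2 + F 3 + F c = 0 := by linarith
  have hFc : F c = M w c * (ind (x = j) - ind (y = j)) := by
    rw [hF]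
    beta_reduce
    rw [stdMap_self H.mem]
  rwa [hFc] at h0

theorem TightConst.coeff_small_eq_zero (H : TightConst n K a c d M r t) (hK1 : 3 ≤ K)
    (hK2 : K ≤ n - 3) {w : ℕ} (hw : w ∈ (Icc 4 n).erase c) :
    M w 1 = 0 ∧ M w 2 = 0 ∧ M w 3 = 0 ∧ M w c = 0 := by
  have hc := mem_Icc.1 H.mem
  have had := H.ends
  have c1 : 1 ≠ c := by omega
  have c2 : 2 ≠ c := by omega
  have c3 : 3 ≠ c := by omega
  have hw' : w ≠ c ∧ 4 ≤ w ∧ w ≤ n := by rwa [mem_erase, mem_Icc] at hw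
  obtain ⟨k, rfl⟩ : ∃ k, K = k + 3 := ⟨K - 3, by omega⟩
  have p1 : M w a + M w 3 - M w d = 0 := by
    have := H.move (w := w) (i₂ := 2) (i₃ := a) (j := c) hK1 hK2 (k := k) (x := a) (y := d)
    rcases had with ⟨rfl, rfl⟩ | ⟨rfl, rfl⟩ <;>
      norm_num [IsTight, IsSmallRep, ind, c1, c2, c3, c1.symm, c2.symm, c3.symm] at this <;>
      linarith [this (by omega) (by omega) hw'.1 hw'.2.1 hw'.2.2]
  have p2 : M w 1 + M w 2 - M w 3 = 0 := by
    have := H.move (w := w) (i₂ := 1) (i₃ := 3) (j := c) hK1 hK2 (k := k) (x := 1) (y := 3)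
    rcases had with ⟨rfl, rfl⟩ | ⟨rfl, rfl⟩ <;>
      norm_num [IsTight, IsSmallRep, ind, c1, c2, c3, c1.symm, c2.symm, c3.symm] at this <;>
      linarith [this (by omega) (by omega) hw'.1 hw'.2.1 hw'.2.2]
  have p3 : M w 1 + M w 2 - M w 3 - M w c = 0 := by
    have := H.move (w := w) (i₂ := 1) (i₃ := 3) (j := 3) hK1 hK2 (k := k + 1) (x := 1) (y := 3)
    rcases had with ⟨rfl, rfl⟩ | ⟨rfl, rfl⟩ <;>
      norm_num [IsTight, IsSmallRep, ind, c1, c2, c3, c1.symm, c2.symm, c3.symm] at this <;>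
      linarith [this (by omega) (by omega) hw'.1 hw'.2.1 hw'.2.2]
  have p4 : M w a - M w 3 - M w c - M w d = 0 := by
    have := H.move (w := w) (i₂ := 2) (i₃ := d) (j := d) hK1 hK2 (k := k + 1) (x := a) (y := d)
    rcases had with ⟨rfl, rfl⟩ | ⟨rfl, rfl⟩ <;>
      norm_num [IsTight, IsSmallRep, ind, c1, c2, c3, c1.symm, c2.symm, c3.symm] at this <;>
      linarith [this (by omega) (by omega) hw'.1 hw'.2.1 hw'.2.2]
  rcases had with ⟨rfl, rfl⟩ | ⟨rfl, rfl⟩ <;> refine ⟨?_, ?_, ?_, ?_⟩ <;> linarith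

theorem quad_eq (hc : c ∈ Icc 4 n) (hM : ∀ u v, M u v = M v u)
    (hW : ∀ w ∈ (Icc 4 n).erase c, ∀ w' ∈ (Icc 4 n).erase c, w ≠ w' → M w w' = 0)
    (hs : ∀ w ∈ (Icc 4 n).erase c, M w 1 = 0 ∧ M w 2 = 0 ∧ M w 3 = 0 ∧ M w c = 0)
    (σ : ℕ → ℕ) :
    quad n M r σ = ∑ v ∈ Icc 1 n, M v v + 2 * M 1 2 * ind (σ 1 = σ 2) +
      2 * M 1 3 * ind (σ 1 = σ 3) + 2 * M 2 3 * ind (σ 2 = σ 3) + 2 * M 1 c * ind (σ 1 = σ c) +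
      2 * M 2 c * ind (σ 2 = σ c) + 2 * M 3 c * ind (σ 3 = σ c) + r c * ind (σ c = c) +
      ∑ v ∈ (Icc 4 n).erase c, r v * ind (σ v = v) := by
  have hinner : ∀ w ∈ (Icc 4 n).erase c,
      ∑ v ∈ Icc 1 n, M w v * ind (σ w = σ v) = M w w := by
    intro w hw
    obtain ⟨h1, h2, h3, h4⟩ := hs w hw
    rw [sum_Icc_eq hc, h1, h2, h3, h4, sum_eq_single_of_mem w hw fun v hv hvw => by
      rw [hW w hw v hv hvw.symm, zero_mul], ind_pos rfl]
    ring
  have houter : ∀ u, (∀ w ∈ (Icc 4 n).erase c, M w u = 0) →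
      ∑ v ∈ (Icc 4 n).erase c, M u v * ind (σ u = σ v) = 0 := fun u hu =>
    sum_eq_zero fun v hv => by rw [hM, hu v hv, zero_mul]
  rw [quad, sum_Icc_eq hc, sum_congr rfl hinner, sum_Icc_eq hc, sum_Icc_eq hc, sum_Icc_eq hc,
    sum_Icc_eq hc, sum_Icc_eq hc, houter 1 fun w hw => (hs w hw).1,
    houter 2 fun w hw => (hs w hw).2.1, houter 3 fun w hw => (hs w hw).2.2.1,
    houter c fun w hw => (hs w hw).2.2.2, ← add_sum_erase _ _ hc, hM 2 1, hM 3 1, hM 3 2,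
    hM c 1, hM c 2, hM c 3]
  simp only [ind_pos, eq_comm (a := σ 2) (b := σ 1), eq_comm (a := σ 3) (b := σ 1),
    eq_comm (a := σ 3) (b := σ 2), eq_comm (a := σ c) (b := σ 1), eq_comm (a := σ c) (b := σ 2),
    eq_comm (a := σ c) (b := σ 3)]
  ring

theorem TightConst.exists_affine (H : TightConst n K a c d M r t) (hK1 : 3 ≤ K)
    (hK2 : K ≤ n - 3) : ∃ l t' : ℝ, ∀ σ, quad n M r σ = l * pawForm n a c d (repVec n σ) + t' := by
  have hc := mem_Icc.1 H.mem
  have had := H.ends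
  have c1 : 1 ≠ c := by omega
  have c2 : 2 ≠ c := by omega
  have c3 : 3 ≠ c := by omega
  have hq := quad_eq (r := r) H.mem H.symm
    (fun w hw w' hw' => H.coeff_eq_zero hK1 hK2 hw hw')
    fun w hw => H.coeff_small_eq_zero hK1 hK2 hw
  set Δ := ∑ v ∈ Icc 1 n, M v v
  have hval : ∀ {i₂ i₃ j : ℕ} {S : Finset ℕ}, IsTight a d c i₂ i₃ j →
      IsStd n K c i₂ i₃ j S (fun _ => 1) →
      Δ + 2 * M 1 2 * ind (1 = i₂) + 2 * M 1 3 * ind (1 = i₃) + 2 * M 2 3 * ind (i₂ = i₃) +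
        2 * M 1 c * ind (1 = j) + 2 * M 2 c * ind (i₂ = j) + 2 * M 3 c * ind (i₃ = j) +
        r c * ind (j = c) + ∑ v ∈ S, r v = t := by
    intro i₂ i₃ j S ht h
    rw [← H.quad_stdMap ht h, hq, h.sum_rest, stdMap_one, stdMap_two, stdMap_three,
      stdMap_self H.mem]
  obtain ⟨γ, hγ⟩ : ∃ γ, ∀ w ∈ (Icc 4 n).erase c, r w = γ := by
    obtain ⟨w₀, hw₀⟩ : ((Icc 4 n).erase c).Nonempty := by
      rw [← card_pos, card_Icc_erase H.mem]
      omega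
    refine ⟨r w₀, fun w hw => ?_⟩
    by_cases hne : w = w₀
    · rw [hne]
    obtain ⟨S, hS, hScard⟩ : ∃ S ⊆ (((Icc 4 n).erase c).erase w).erase w₀, #S = K - 3 := by
      apply exists_subset_card_eq
      rw [card_erase_of_mem (mem_erase.2 ⟨Ne.symm hne, hw₀⟩), card_erase_of_mem hw,
        card_Icc_erase H.mem]
      omega
    have hS' := hS.trans (erase_subset _ _)
    have hwS : w ∉ S := fun h => (mem_erase.1 (hS' h)).1 rfl
    have hwS' : w₀ ∉ S := fun h => (mem_erase.1 (hS h)).1 rfl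
    have ht : IsTight a d c 1 3 3 := by
      rcases had with ⟨rfl, rfl⟩ | ⟨rfl, rfl⟩ <;> norm_num [IsTight, ind, c3]
    have hstd : ∀ u ∈ (Icc 4 n).erase c, u ∉ S → IsStd n K c 1 3 3 (insert u S) fun _ => 1 := by
      refine fun u hu huS => ⟨by simp, by simp, .inl (.inr (.inr ⟨rfl, rfl⟩)), fun _ => .inl rfl,
        insert_subset hu (hS'.trans (erase_subset _ _)), ?_⟩
      rw [card_insert_of_notMem huS, hScard, if_neg (by omega), if_pos rfl, if_neg c3]
      omega
    have e1 := hval ht (hstd w hw hwS)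
    have e2 := hval ht (hstd w₀ hw₀ hwS')
    rw [sum_insert hwS] at e1
    rw [sum_insert hwS'] at e2
    linarith
  have hvalk : ∀ {i₂ i₃ j : ℕ} (k : ℕ), IsTight a d c i₂ i₃ j → i₂ = 1 ∨ i₂ = 2 →
      i₃ = 1 ∨ i₃ = 2 ∧ i₂ = 2 ∨ i₃ = 3 → IsSmallRep i₂ i₃ j ∨ j = c →
      (1 + if i₂ = 2 then 1 else 0) + (if i₃ = 3 then 1 else 0) +
        (if j = c then 1 else 0) + k = K → k ≤ n - 4 →
      Δ + 2 * M 1 2 * ind (1 = i₂) + 2 * M 1 3 * ind (1 = i₃) + 2 * M 2 3 * ind (i₂ = i₃) +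
        2 * M 1 c * ind (1 = j) + 2 * M 2 c * ind (i₂ = j) + 2 * M 3 c * ind (i₃ = j) +
        r c * ind (j = c) + k * γ = t := by
    intro i₂ i₃ j k ht two three val hk hkn
    obtain ⟨S, hS, hScard⟩ : ∃ S ⊆ (Icc 4 n).erase c, #S = k := by
      apply exists_subset_card_eq
      rwa [card_Icc_erase H.mem]
    rw [← hval ht ⟨two, three, val, fun _ => .inl rfl, hS, hScard ▸ hk⟩,
      sum_congr rfl fun v hv => hγ v (hS hv), sum_const, hScard, nsmul_eq_mul]
  obtain ⟨k, rfl⟩ : ∃ k, K = k + 3 := ⟨K - 3, by omega⟩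
  have q1 := @hvalk 1 1 1 (k + 2)
  have q2 := @hvalk 1 3 3 (k + 1)
  have q3 := @hvalk 2 d d (k + 1)
  have q4 := @hvalk 2 a d (k + 1)
  have q5 := @hvalk 1 1 c (k + 1)
  have q6 := @hvalk 1 3 c k
  have q7 := @hvalk 2 3 3 k
  have q8 := @hvalk 2 3 d k
  have q9 := @hvalk 2 a c k
  have hk1 : k + 2 ≤ n - 4 := by omega
  have hk2 : k + 1 ≤ n - 4 := by omega
  have hk3 : k ≤ n - 4 := by omega
  refine ⟨-γ, Δ, fun σ => ?_⟩
  rw [hq, pawForm_repVec σ (mem_Icc.2 (by omega)) H.mem (mem_Icc.2 (by omega)),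
    sum_congr rfl fun v hv => by rw [hγ v hv], ← mul_sum]
  clear hval hvalk hq hγ
  rcases had with ⟨rfl, rfl⟩ | ⟨rfl, rfl⟩ <;>
    norm_num [IsTight, IsSmallRep, ind, c1, c2, c3, c1.symm, c2.symm, c3.symm]
      at q1 q2 q3 q4 q5 q6 q7 q8 q9 <;>
    replace q1 := q1 (by omega) hk1 <;> replace q2 := q2 (by omega) hk2 <;>
    replace q3 := q3 (by omega) hk2 <;> replace q4 := q4 (by omega) hk2 <;>
    replace q5 := q5 (by omega) hk2 <;> replace q6 := q6 (by omega) hk3 <;>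
    replace q7 := q7 (by omega) hk3 <;> replace q8 := q8 (by omega) hk3 <;>
    replace q9 := q9 (by omega) hk3
  · rw [show 2 * M 1 2 = -γ by linarith, show 2 * M 1 3 = -γ by linarith,
      show 2 * M 2 3 = 0 by linarith, show 2 * M 1 c = γ by linarith,
      show 2 * M 2 c = -γ by linarith, show 2 * M 3 c = -γ by linarith,
      show r c = 0 by linarith]
    simp only [eq_comm (a := σ c) (b := σ 2)]
    ring
  · rw [show 2 * M 1 2 = -γ by linarith, show 2 * M 1 3 = 0 by linarith,
      show 2 * M 2 3 = -γ by linarith, show 2 * M 1 c = -γ by linarith,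
      show 2 * M 2 c = γ by linarith, show 2 * M 3 c = -γ by linarith,
      show r c = 0 by linarith]
    simp only [eq_comm (a := σ c) (b := σ 1)]
    ring

end coefficients

theorem exists_tight {n K a c d : ℕ} (hK1 : 3 ≤ K) (hK2 : K ≤ n - 3) (hc : c ∈ Icc 4 n)
    (had : a = 1 ∧ d = 2 ∨ a = 2 ∧ d = 1) :
    ∃ σ, IsRepMap n K σ ∧ pawForm n a c d (repVec n σ) = 4 - K := by
  have hc' := mem_Icc.1 hc
  obtain ⟨S, hS, hScard⟩ : ∃ S ⊆ (Icc 4 n).erase c, #S = K - 2 := by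
    apply exists_subset_card_eq
    rw [card_Icc_erase hc]
    omega
  have hstd : IsStd n K c 1 3 3 S fun _ => 1 :=
    ⟨.inl rfl, .inr (.inr rfl), .inl (.inr (.inr ⟨rfl, rfl⟩)), fun _ => .inl rfl, hS, by
      rw [if_neg (by omega), if_pos rfl, if_neg (by omega)]; omega⟩
  refine ⟨_, hstd.isRepMap hc, ?_⟩
  have c3 : 3 ≠ c := by omega
  rw [hstd.pawForm_eq hc (mem_Icc.2 (by omega)) (mem_Icc.2 (by omega)) (A := 1) (D := 1)
    (by rcases had with ⟨rfl, -⟩ | ⟨rfl, -⟩ <;> rfl)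
    (by rcases had with ⟨-, rfl⟩ | ⟨-, rfl⟩ <;> rfl)]
  norm_num [ind, c3]

theorem exists_not_tight {n K a c d : ℕ} (hK1 : 3 ≤ K) (hK2 : K ≤ n - 3) (hc : c ∈ Icc 4 n)
    (had : a = 1 ∧ d = 2 ∨ a = 2 ∧ d = 1) :
    ∃ σ, IsRepMap n K σ ∧ pawForm n a c d (repVec n σ) ≠ 4 - K := by
  have hc' := mem_Icc.1 hc
  obtain ⟨S, hS, hScard⟩ : ∃ S ⊆ (Icc 4 n).erase c, #S = K - 2 := by
    apply exists_subset_card_eq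
    rw [card_Icc_erase hc]
    omega
  have hstd : IsStd n K c 2 a a S fun _ => 1 :=
    ⟨.inr rfl, by omega, .inl (by unfold IsSmallRep; omega), fun _ => .inl rfl, hS, by
      rw [if_pos rfl, if_neg (by omega), if_neg (by omega)]; omega⟩
  refine ⟨_, hstd.isRepMap hc, ?_⟩
  have hval : ∀ e, e = 1 ∨ e = 2 → stdMap c 2 a a S (fun _ => 1) e = e := by
    rintro e (rfl | rfl) <;> rfl
  rw [hstd.pawForm_eq hc (mem_Icc.2 (by omega)) (mem_Icc.2 (by omega))
    (hval a (by omega)) (hval d (by omega))]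
  have c1 : 1 ≠ c := by omega
  have c2 : 2 ≠ c := by omega
  intro h
  rcases had with ⟨rfl, rfl⟩ | ⟨rfl, rfl⟩ <;> norm_num [ind, c1, c2] at h

theorem isSmallRep_update (w v : ℕ) : IsSmallRep 1 3 (Function.update (fun _ => 1) w 3 v) := by
  rw [Function.update_apply]
  split_ifs
  · exact .inr (.inr ⟨rfl, rfl⟩)
  · exact .inl rfl

theorem exists_lt_of_four_le_right {n K a c d : ℕ} (hK1 : 3 ≤ K) (hK2 : K ≤ n - 3)
    (hc : c ∈ Icc 4 n) (ha : a ∈ Icc 1 n) (hd : d ∈ Icc 4 n) (ha3 : a ≠ 3) (hac : a ≠ c)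
    (had : a ≠ d) (hcd : c ≠ d) :
    ∃ σ, IsRepMap n K σ ∧ 4 - K < pawForm n a c d (repVec n σ) := by
  have hc' := mem_Icc.1 hc
  have ha' := mem_Icc.1 ha
  have hd' := mem_Icc.1 hd
  have hdW : d ∈ (Icc 4 n).erase c := mem_erase.2 ⟨hcd.symm, hd⟩
  obtain ⟨S, hS, hScard⟩ : ∃ S ⊆ ((Icc 4 n).erase c).erase d, #S = K - 2 := by
    apply exists_subset_card_eq
    rw [card_erase_of_mem hdW, card_Icc_erase hc]
    omega
  have hstd : IsStd n K c 1 3 3 S (Function.update (fun _ => 1) d 3) :=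
    ⟨.inl rfl, .inr (.inr rfl), .inl (.inr (.inr ⟨rfl, rfl⟩)), isSmallRep_update d,
      hS.trans (erase_subset _ _), by
      rw [if_neg (by omega), if_pos rfl, if_neg (by omega)]; omega⟩
  refine ⟨_, hstd.isRepMap hc, ?_⟩
  have hA : stdMap c 1 3 3 S (Function.update (fun _ => 1) d 3) a ≠ 3 := by
    rcases (by omega : a = 1 ∨ a = 2 ∨ 4 ≤ a) with rfl | rfl | h
    · exact (by decide : 1 ≠ 3)
    · exact (by decide : 1 ≠ 3)
    · rw [stdMap_rest (mem_erase.2 ⟨hac, mem_Icc.2 ⟨h, ha'.2⟩⟩), Function.update_of_ne had]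
      split_ifs <;> omega
  have c3 : 3 ≠ c := by omega
  rw [hstd.pawForm_eq hc ha (mem_Icc.2 (by omega)) rfl
    (stdMap_update_self hdW fun h => (mem_erase.1 (hS h)).1 rfl)]
  norm_num [ind, hA, c3]

theorem exists_lt_of_four_le_left {n K a c d : ℕ} (hK1 : 3 ≤ K) (hK2 : K ≤ n - 3)
    (hc : c ∈ Icc 4 n) (ha : a ∈ Icc 4 n) (hac : a ≠ c) (hd : d = 1 ∨ d = 2) :
    ∃ σ, IsRepMap n K σ ∧ 4 - K < pawForm n a c d (repVec n σ) := by
  have hc' := mem_Icc.1 hc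
  have ha' := mem_Icc.1 ha
  have haW : a ∈ (Icc 4 n).erase c := mem_erase.2 ⟨hac, ha⟩
  obtain ⟨S, hS, hScard⟩ : ∃ S ⊆ ((Icc 4 n).erase c).erase a, #S = K - 3 := by
    apply exists_subset_card_eq
    rw [card_erase_of_mem haW, card_Icc_erase hc]
    omega
  have hstd : IsStd n K c 1 3 c S (Function.update (fun _ => 1) a 3) :=
    ⟨.inl rfl, .inr (.inr rfl), .inr rfl, isSmallRep_update a, hS.trans (erase_subset _ _), by
      rw [if_neg (by omega), if_pos rfl, if_pos rfl]; omega⟩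
  refine ⟨_, hstd.isRepMap hc, ?_⟩
  have c1 : c ≠ 1 := by omega
  have c3 : 3 ≠ c := by omega
  rw [hstd.pawForm_eq hc (mem_Icc.2 (by omega)) (mem_Icc.2 (by omega))
    (stdMap_update_self haW fun h => (mem_erase.1 (hS h)).1 rfl)
    (D := 1) (by rcases hd with rfl | rfl <;> rfl)]
  norm_num [ind, c1, c3]

/-- For `n ≥ 6`, `3 ≤ K ≤ n-3` and pairwise distinct `a, c, d ∈ V ∖ {3}` with
`c ∈ {4,…,n}`, the inequality
`x_{a,3} + x_{3,c} - x_{a,c} + x_{c,d} + x_c + x_{1,2} - Σ_{i=4}^n x_i ≤ 4 - K`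
(the paw inequality for `b = 3` in the variables of `P_{n,K}`) is facet-defining for
`P_{n,K}` iff `d < 3` and `a < 3`. -/
theorem paw3_facet (n K a c d : ℕ) (hn : 6 ≤ n) (hK1 : 3 ≤ K) (hK2 : K ≤ n - 3)
    (ha : a ∈ Finset.Icc 1 n) (hc : c ∈ Finset.Icc 4 n) (hd : d ∈ Finset.Icc 1 n)
    (ha3 : a ≠ 3) (hd3 : d ≠ 3)
    (hac : a ≠ c) (had : a ≠ d) (hcd : c ≠ d) :
    IsFacetLe n K
        (fun x => x.1 (a, 3) + x.1 (3, c) - x.1 (a, c) + x.1 (c, d) + x.2 c + x.1 (1, 2) -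
          ∑ i ∈ Finset.Icc 4 n, x.2 i)
        ((4 : ℝ) - (K : ℝ)) ↔
      (d < 3 ∧ a < 3) := by
  have hrep := setOf_charVec_eq n K
  constructor
  · rintro ⟨hvalid, -⟩
    have hnot : ¬∃ σ, IsRepMap n K σ ∧ 4 - K < pawForm n a c d (repVec n σ) := by
      rintro ⟨σ, hσ, hlt⟩
      refine absurd (hvalid (repVec n σ) (subset_convexHull ℝ _ ?_)) (not_le.2 hlt)
      rw [hrep]
      exact ⟨σ, hσ, rfl⟩
    have ha' := mem_Icc.1 ha
    have hd' := mem_Icc.1 hd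
    by_contra hcon
    rcases Nat.lt_or_ge d 4 with h | h
    · exact hnot (exists_lt_of_four_le_left hK1 hK2 hc (mem_Icc.2 (by omega)) hac (by omega))
    · exact hnot (exists_lt_of_four_le_right hK1 hK2 hc ha (mem_Icc.2 ⟨h, hd'.2⟩) ha3 hac had hcd)
  · rintro ⟨hd2, ha2⟩
    have ha' := mem_Icc.1 ha
    have hd' := mem_Icc.1 hd
    have ends : a = 1 ∧ d = 2 ∨ a = 2 ∧ d = 1 := by omega
    constructor
    · change convexHull ℝ _ ⊆ {x | pawForm n a c d x ≤ 4 - K}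
      refine convexHull_min ?_ (convex_halfSpace_le (pawForm n a c d).isLinear _)
      rw [hrep]
      rintro _ ⟨σ, hσ, rfl⟩
      exact pawForm_repVec_le hσ hc ends
    · obtain ⟨σ, hσ, hσ'⟩ := exists_tight hK1 hK2 hc ends
      obtain ⟨τ, hτ, hτ'⟩ := exists_not_tight hK1 hK2 hc ends
      refine adim_face_add_one (finite_setOf_charVec n K) (pawForm n a c d) (4 - K)
        (hrep ▸ ⟨σ, hσ, rfl⟩) hσ' (hrep ▸ ⟨τ, hτ, rfl⟩) hτ' fun g t hg => ?_
      rw [hrep] at hg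
      obtain ⟨M, r, hM, hquad⟩ := exists_quad n g
      have H : TightConst n K a c d M r t :=
        ⟨hc, ends, hM, fun φ hφ h => by rw [← hquad, hg _ ⟨φ, hφ, rfl⟩ h]⟩
      obtain ⟨l, t', hl⟩ := H.exists_affine hK1 hK2
      refine ⟨l, t', ?_⟩
      rw [hrep]
      rintro _ ⟨φ, -, rfl⟩
      rw [hquad, hl]
end

section
/- Let π = {C₁, C₂, C₃, …, C_K} be a K-partition of V, let r₁ and r₂ be the smallest elements of C₁ and C₂, and let c₁ ∈ C₁ ∖ {r₁} and c₂ ∈ C₂ ∖ {r₂}. Let π¹, π², π³ be the K-partitions obtained from π by applying the transformations T(C₁,C₂,{c₁}), T(C₁,C₂,{c₂}), and T(C₁,C₂,{c₁,c₂}) respectively. If α ∈ ℝ^{|E|+n−3} and α₀ ∈ ℝ are such that the characteristic vectors of π, π¹, π², π³ all satisfy α·x = α₀, then α_{c₁,c₂} = 0. -/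
/-- The transformation `T(C₁,C₂,R)` on the clusters of a partition: the elements of `R`
switch between `C₁` and `C₂`, all other clusters are unchanged. -/
def swapParts (parts : Finset (Finset ℕ)) (C₁ C₂ R : Finset ℕ) : Finset (Finset ℕ) :=
  insert ((C₁ \ R) ∪ (R ∩ C₂)) (insert ((C₂ \ R) ∪ (R ∩ C₁)) (parts \ {C₁, C₂}))

/-- The pairing `α·x = Σ_{uv ∈ E} α_{u,v} x_{u,v} + Σ_{v=4}^n α_v x_v`. -/
noncomputable def dotP (n : ℕ) (a x : GPoint) : ℝ :=
  (∑ e ∈ (Finset.Icc 1 n).offDiag.filter (fun e => e.1 < e.2), a.1 e * x.1 e) +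
    ∑ v ∈ Finset.Icc 4 n, a.2 v * x.2 v

/-- The representative coefficient `α_v`, with the convention `α_v = 0` for `v ∈ {1,2,3}`. -/
noncomputable def repCoef (a : GPoint) (v : ℕ) : ℝ :=
  if 4 ≤ v then a.2 v else 0

theorem exists_mem_swapParts_iff (P : Finset (Finset ℕ)) (C₁ C₂ R : Finset ℕ)
    (q : Finset ℕ → Prop) :
    (∃ C ∈ swapParts P C₁ C₂ R, q C) ↔
      q ((C₁ \ R) ∪ (R ∩ C₂)) ∨ q ((C₂ \ R) ∪ (R ∩ C₁)) ∨
        ∃ C ∈ P, (C ≠ C₁ ∧ C ≠ C₂) ∧ q C := by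
  simp only [swapParts, Finset.mem_insert, Finset.mem_sdiff, Finset.mem_singleton, not_or]
  grind

theorem exists_mem_iff_of_mem {P : Finset (Finset ℕ)} {C₁ C₂ : Finset ℕ}
    (hC₁ : C₁ ∈ P) (hC₂ : C₂ ∈ P) (q : Finset ℕ → Prop) :
    (∃ C ∈ P, q C) ↔ q C₁ ∨ q C₂ ∨ ∃ C ∈ P, (C ≠ C₁ ∧ C ≠ C₂) ∧ q C := by
  grind

/-- The predicate of being a least element of `S` singles out the least element `r`. -/
theorem mem_and_forall_le_iff_eq {S : Finset ℕ} {r : ℕ} (hr : r ∈ S) (hmin : ∀ w ∈ S, r ≤ w)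
    (v : ℕ) : (v ∈ S ∧ ∀ w ∈ S, v ≤ w) ↔ v = r := by
  constructor
  · rintro ⟨hv, h⟩
    exact le_antisymm (h r hr) (hmin v hv)
  · rintro rfl
    exact ⟨hr, hmin⟩

/-- The alternating sum of pairings is the pairing with the alternating sum of points. -/
theorem dotP_alternating (n : ℕ) (a x y z w : GPoint) :
    dotP n a x - dotP n a y - dotP n a z + dotP n a w = dotP n a (x - y - z + w) := by
  simp only [dotP, Prod.fst_add, Prod.snd_add, Prod.fst_sub, Prod.snd_sub, Pi.add_apply,
    Pi.sub_apply, mul_add, mul_sub, Finset.sum_add_distrib, Finset.sum_sub_distrib]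
  ring

theorem charVec_edge_alternating {n K : ℕ} {π π₁ π₂ π₃ : KPartition n K}
    {C₁ C₂ : Finset ℕ} (hC₁ : C₁ ∈ π.parts) (hC₂ : C₂ ∈ π.parts) (hCne : C₁ ≠ C₂)
    {c₁ c₂ : ℕ} (hc₁ : c₁ ∈ C₁) (hc₂ : c₂ ∈ C₂)
    (h₁ : π₁.parts = swapParts π.parts C₁ C₂ {c₁})
    (h₂ : π₂.parts = swapParts π.parts C₁ C₂ {c₂})
    (h₃ : π₃.parts = swapParts π.parts C₁ C₂ {c₁, c₂}) {u v : ℕ} (huv : u ≠ v) :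
    (charVec n K π - charVec n K π₁ - charVec n K π₂ + charVec n K π₃).1 (u, v) =
      if (u = c₁ ∧ v = c₂) ∨ (u = c₂ ∧ v = c₁) then -2 else 0 := by
  have hd : ∀ x, x ∈ C₁ → x ∉ C₂ := fun x h h' =>
    Finset.disjoint_left.mp (π.parts_disjoint _ hC₁ _ hC₂ hCne) h h'
  have hO : (∃ C ∈ π.parts, (C ≠ C₁ ∧ C ≠ C₂) ∧ u ∈ C ∧ v ∈ C) →
      u ∉ C₁ ∧ u ∉ C₂ ∧ v ∉ C₁ ∧ v ∉ C₂ := by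
    rintro ⟨C, hC, ⟨hn₁, hn₂⟩, hu, hv⟩
    have e₁ := Finset.disjoint_left.mp (π.parts_disjoint _ hC _ hC₁ hn₁)
    have e₂ := Finset.disjoint_left.mp (π.parts_disjoint _ hC _ hC₂ hn₂)
    exact ⟨e₁ hu, e₂ hu, e₁ hv, e₂ hv⟩
  simp only [charVec, Prod.fst_add, Prod.fst_sub, Pi.add_apply, Pi.sub_apply, h₁, h₂, h₃,
    exists_mem_swapParts_iff, exists_mem_iff_of_mem hC₁ hC₂ (fun C => u ∈ C ∧ v ∈ C)]
  classical
  obtain ⟨O, hO'⟩ : ∃ O : Prop, (∃ C ∈ π.parts, (C ≠ C₁ ∧ C ≠ C₂) ∧ u ∈ C ∧ v ∈ C) ↔ O :=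
    ⟨_, Iff.rfl⟩
  simp only [hO'] at hO ⊢
  clear hO'
  simp only [Finset.mem_union, Finset.mem_sdiff, Finset.mem_inter, Finset.mem_singleton,
    Finset.mem_insert]
  have hc₁' := hd c₁ hc₁
  have hc₂' : c₂ ∉ C₁ := fun h => hd c₂ h hc₂
  have hu := hd u
  have hv := hd v
  have hcc : c₁ ≠ c₂ := fun h => hc₁' (h ▸ hc₂)
  have hcc' := hcc.symm
  by_cases u1 : u = c₁
  · subst u1
    by_cases v2 : v = c₂
    · subst v2
      by_cases o : O <;> simp_all; norm_num
    · by_cases o : O <;> by_cases vC : v ∈ C₁ <;> by_cases vD : v ∈ C₂ <;>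
        simp_all [huv.symm]
  by_cases u2 : u = c₂
  · subst u2
    by_cases v1 : v = c₁
    · subst v1
      by_cases o : O <;> simp_all; norm_num
    · by_cases o : O <;> by_cases vC : v ∈ C₁ <;> by_cases vD : v ∈ C₂ <;>
        simp_all [huv.symm]
  by_cases v1 : v = c₁
  · subst v1
    by_cases o : O <;> by_cases uC : u ∈ C₁ <;> by_cases uD : u ∈ C₂ <;> simp_all
  by_cases v2 : v = c₂
  · subst v2
    by_cases o : O <;> by_cases uC : u ∈ C₁ <;> by_cases uD : u ∈ C₂ <;> simp_all
  simp [u1, u2, v1, v2]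

theorem charVec_rep_alternating {n K : ℕ} {π π₁ π₂ π₃ : KPartition n K}
    {C₁ C₂ : Finset ℕ} (hC₁ : C₁ ∈ π.parts) (hC₂ : C₂ ∈ π.parts) (hCne : C₁ ≠ C₂)
    {r₁ r₂ c₁ c₂ : ℕ}
    (hr₁ : r₁ ∈ C₁) (hr₁min : ∀ w ∈ C₁, r₁ ≤ w)
    (hr₂ : r₂ ∈ C₂) (hr₂min : ∀ w ∈ C₂, r₂ ≤ w)
    (hc₁ : c₁ ∈ C₁) (hc₁ne : c₁ ≠ r₁)
    (hc₂ : c₂ ∈ C₂) (hc₂ne : c₂ ≠ r₂)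
    (h₁ : π₁.parts = swapParts π.parts C₁ C₂ {c₁})
    (h₂ : π₂.parts = swapParts π.parts C₁ C₂ {c₂})
    (h₃ : π₃.parts = swapParts π.parts C₁ C₂ {c₁, c₂}) (v : ℕ) :
    (charVec n K π - charVec n K π₁ - charVec n K π₂ + charVec n K π₃).2 v = 0 := by
  have hd : ∀ x, x ∈ C₁ → x ∉ C₂ := fun x h h' =>
    Finset.disjoint_left.mp (π.parts_disjoint _ hC₁ _ hC₂ hCne) h h'
  have hO : (∃ C ∈ π.parts, (C ≠ C₁ ∧ C ≠ C₂) ∧ v ∈ C ∧ ∀ w ∈ C, v ≤ w) →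
      v ∉ C₁ ∧ v ∉ C₂ := by
    rintro ⟨C, hC, ⟨hn₁, hn₂⟩, hv, -⟩
    exact ⟨Finset.disjoint_left.mp (π.parts_disjoint _ hC _ hC₁ hn₁) hv,
      Finset.disjoint_left.mp (π.parts_disjoint _ hC _ hC₂ hn₂) hv⟩
  have hc₁' := hd c₁ hc₁
  have hc₂' : c₂ ∉ C₁ := fun h => hd c₂ h hc₂
  have hr₁' := hd r₁ hr₁
  have hr₂' : r₂ ∉ C₁ := fun h => hd r₂ h hr₂
  have a₁ := mem_and_forall_le_iff_eq hr₁ hr₁min v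
  have a₂ := mem_and_forall_le_iff_eq hr₂ hr₂min v
  have b₁ := mem_and_forall_le_iff_eq (S := (C₁ \ {c₁}) ∪ ({c₁} ∩ C₂)) (r := r₁)
    (by grind) (by grind) v
  have b₂ := mem_and_forall_le_iff_eq (S := (C₂ \ {c₁}) ∪ ({c₁} ∩ C₁)) (r := min r₂ c₁)
    (by grind) (by grind) v
  have d₁ := mem_and_forall_le_iff_eq (S := (C₁ \ {c₂}) ∪ ({c₂} ∩ C₂)) (r := min r₁ c₂)
    (by grind) (by grind) v
  have d₂ := mem_and_forall_le_iff_eq (S := (C₂ \ {c₂}) ∪ ({c₂} ∩ C₁)) (r := r₂)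
    (by grind) (by grind) v
  have e₁ := mem_and_forall_le_iff_eq (S := (C₁ \ {c₁, c₂}) ∪ ({c₁, c₂} ∩ C₂))
    (r := min r₁ c₂) (by grind) (by grind) v
  have e₂ := mem_and_forall_le_iff_eq (S := (C₂ \ {c₁, c₂}) ∪ ({c₁, c₂} ∩ C₁))
    (r := min r₂ c₁) (by grind) (by grind) v
  simp only [charVec, Prod.snd_add, Prod.snd_sub, Pi.add_apply, Pi.sub_apply, h₁, h₂, h₃,
    exists_mem_swapParts_iff,
    exists_mem_iff_of_mem hC₁ hC₂ (fun C => v ∈ C ∧ ∀ w ∈ C, v ≤ w),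
    a₁, a₂, b₁, b₂, d₁, d₂, e₁, e₂]
  classical
  obtain ⟨O, hO'⟩ : ∃ O : Prop, (∃ C ∈ π.parts, (C ≠ C₁ ∧ C ≠ C₂) ∧ v ∈ C ∧ ∀ w ∈ C, v ≤ w) ↔ O :=
    ⟨_, Iff.rfl⟩
  simp only [hO'] at hO ⊢
  clear hO'
  clear a₁ a₂ b₁ b₂ d₁ d₂ e₁ e₂ h₁ h₂ h₃
  have hm₁ : min r₁ c₂ = r₁ ∨ min r₁ c₂ = c₂ := by grind
  have hm₂ : min r₂ c₁ = r₂ ∨ min r₂ c₁ = c₁ := by grind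
  by_cases h4 : 4 ≤ v
  · by_cases o : O
    · simp [h4, o]
    · simp only [h4, o, true_and, or_false]
      grind
  · simp [h4]

/-- Lemma 1: if the characteristic vectors of `π` and of the partitions obtained by
`T(C₁,C₂,{c₁})`, `T(C₁,C₂,{c₂})`, `T(C₁,C₂,{c₁,c₂})` (where `c₁ ∈ C₁ ∖ {r₁}` and
`c₂ ∈ C₂ ∖ {r₂}`) all lie on the hyperplane `α·x = α₀`, then `α_{c₁,c₂} = 0`. -/
theorem lemma1 (n K : ℕ) (π π₁ π₂ π₃ : KPartition n K)
    (C₁ C₂ : Finset ℕ) (hC₁ : C₁ ∈ π.parts) (hC₂ : C₂ ∈ π.parts) (hCne : C₁ ≠ C₂)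
    (r₁ r₂ c₁ c₂ : ℕ)
    (hr₁ : r₁ ∈ C₁) (hr₁min : ∀ w ∈ C₁, r₁ ≤ w)
    (hr₂ : r₂ ∈ C₂) (hr₂min : ∀ w ∈ C₂, r₂ ≤ w)
    (hc₁ : c₁ ∈ C₁) (hc₁ne : c₁ ≠ r₁)
    (hc₂ : c₂ ∈ C₂) (hc₂ne : c₂ ≠ r₂)
    (h₁ : π₁.parts = swapParts π.parts C₁ C₂ {c₁})
    (h₂ : π₂.parts = swapParts π.parts C₁ C₂ {c₂})
    (h₃ : π₃.parts = swapParts π.parts C₁ C₂ {c₁, c₂})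
    (a : GPoint) (hsym : ∀ u v, a.1 (u, v) = a.1 (v, u)) (a₀ : ℝ)
    (hπ : dotP n a (charVec n K π) = a₀)
    (hπ₁ : dotP n a (charVec n K π₁) = a₀)
    (hπ₂ : dotP n a (charVec n K π₂) = a₀)
    (hπ₃ : dotP n a (charVec n K π₃) = a₀) :
    a.1 (c₁, c₂) = 0 := by
  have hmem : ∀ C ∈ π.parts, ∀ c ∈ C, c ∈ Finset.Icc 1 n := fun C hC c hc => by
    rw [← π.parts_cover]
    exact Finset.mem_sup.mpr ⟨C, hC, hc⟩
  have hcc : c₁ ≠ c₂ := fun h =>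
    Finset.disjoint_left.mp (π.parts_disjoint _ hC₁ _ hC₂ hCne) hc₁ (h ▸ hc₂)
  have hm₁ := hmem _ hC₁ _ hc₁
  have hm₂ := hmem _ hC₂ _ hc₂
  have key := dotP_alternating n a (charVec n K π) (charVec n K π₁) (charVec n K π₂)
    (charVec n K π₃)
  rw [hπ, hπ₁, hπ₂, hπ₃, dotP] at key
  simp only [charVec_rep_alternating hC₁ hC₂ hCne hr₁ hr₁min hr₂ hr₂min hc₁ hc₁ne hc₂ hc₂ne
    h₁ h₂ h₃, mul_zero, Finset.sum_const_zero, add_zero] at key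
  have hedge := fun (u v : ℕ) (h : u < v) =>
    charVec_edge_alternating hC₁ hC₂ hCne hc₁ hc₂ h₁ h₂ h₃ h.ne
  have hmin : a.1 (min c₁ c₂, max c₁ c₂) = a.1 (c₁, c₂) := by
    rcases le_total c₁ c₂ with h | h
    · simp [h]
    · simp [h, hsym c₁ c₂]
  rw [Finset.sum_eq_single (min c₁ c₂, max c₁ c₂)] at key
  · rw [hedge _ _ (min_lt_max.mpr hcc), if_pos (by grind), hmin] at key
    linarith
  · rintro ⟨u, v⟩ he hne
    have huv : u < v := (Finset.mem_filter.mp he).2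
    rw [hedge u v huv, if_neg, mul_zero]
    rintro (⟨rfl, rfl⟩ | ⟨rfl, rfl⟩)
    · exact hne (by simp [huv.le])
    · exact hne (by simp [huv.le])
  · intro h
    exact absurd (by grind) h
end

section
/- Let π = {C₁, C₂, C₃, …, C_K} be a K-partition of V with |C₁| ≥ 2 and |C₂| ≥ 2, let r₁, r₂ be the smallest elements of C₁, C₂ and r′₁, r′₂ their second-smallest elements, and assume r₁ < r₂ < r′₁. Let π¹, π², π³ be the K-partitions obtained from π by applying the transformations T(C₁,C₂,{r₁}), T(C₁,C₂,{r₂}), and T(C₁,C₂,{r₁,r₂}) respectively. If α ∈ ℝ^{|E|+n−3} and α₀ ∈ ℝ are such that the characteristic vectors of π, π¹, π², π³ all satisfy α·x = α₀, then 2·α_{r₁,r₂} + α_{r′₁} + α_{r′₂} = 2·α_{r₂} (with the convention α_v = 0 for v ∈ {1,2,3}). -/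
open Classical in
/-- Edge components when the clusters are `D₁`, `D₂` and those of `rest`. -/
theorem charVec_fst_of_parts {n K : ℕ} (π : KPartition n K) {D₁ D₂ : Finset ℕ}
    {rest : Finset (Finset ℕ)} (h : π.parts = insert D₁ (insert D₂ rest)) (u v : ℕ) :
    (charVec n K π).1 (u, v) =
      if (u ∈ D₁ ∧ v ∈ D₁) ∨ (u ∈ D₂ ∧ v ∈ D₂) ∨ ∃ C ∈ rest, u ∈ C ∧ v ∈ C then 1 else 0 := by
  simp only [charVec, h, Finset.exists_mem_insert]

open Classical in
/-- Representative components when the clusters are `D₁`, `D₂`, with least elements `m₁`, `m₂`,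
and those of `rest`. -/
theorem charVec_snd_of_parts {n K : ℕ} (π : KPartition n K) {D₁ D₂ : Finset ℕ}
    {rest : Finset (Finset ℕ)} (h : π.parts = insert D₁ (insert D₂ rest)) {m₁ m₂ : ℕ}
    (hm₁ : IsLeast (D₁ : Set ℕ) m₁) (hm₂ : IsLeast (D₂ : Set ℕ) m₂) {v : ℕ} (hv : 4 ≤ v) :
    (charVec n K π).2 v =
      if v = m₁ ∨ v = m₂ ∨ ∃ C ∈ rest, v ∈ C ∧ ∀ w ∈ C, v ≤ w then 1 else 0 := by
  have key : ∀ {D : Finset ℕ} {m : ℕ}, IsLeast (D : Set ℕ) m →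
      ((v ∈ D ∧ ∀ w ∈ D, v ≤ w) ↔ v = m) := by
    intro D m hm
    constructor
    · rintro ⟨h1, h2⟩
      exact le_antisymm (h2 _ hm.1) (hm.2 h1)
    · rintro rfl
      exact ⟨hm.1, fun w hw => hm.2 hw⟩
  simp only [charVec, h, Finset.exists_mem_insert, key hm₁, key hm₂, hv, true_and]

/-- Lemma 3: with `|C₁| ≥ 2`, `|C₂| ≥ 2`, `r₁ < r₂ < r₁'`, where `r₁', r₂'` are the
second-smallest elements of `C₁, C₂`, if the characteristic vectors of `π` and of the
partitions obtained by `T(C₁,C₂,{r₁})`, `T(C₁,C₂,{r₂})`, `T(C₁,C₂,{r₁,r₂})` all lie on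
the hyperplane `α·x = α₀`, then `2α_{r₁,r₂} + α_{r₁'} + α_{r₂'} = 2α_{r₂}`. -/
theorem lemma4 (n K : ℕ) (π π₁ π₂ π₃ : KPartition n K)
    (C₁ C₂ : Finset ℕ) (hC₁ : C₁ ∈ π.parts) (hC₂ : C₂ ∈ π.parts) (hCne : C₁ ≠ C₂)
    (hC₁card : 2 ≤ C₁.card) (hC₂card : 2 ≤ C₂.card)
    (r₁ r₂ r₁' r₂' : ℕ)
    (hr₁ : r₁ ∈ C₁) (hr₁min : ∀ w ∈ C₁, r₁ ≤ w)
    (hr₂ : r₂ ∈ C₂) (hr₂min : ∀ w ∈ C₂, r₂ ≤ w)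
    (hr₁' : r₁' ∈ C₁) (hr₁'ne : r₁' ≠ r₁) (hr₁'min : ∀ w ∈ C₁, w ≠ r₁ → r₁' ≤ w)
    (hr₂' : r₂' ∈ C₂) (hr₂'ne : r₂' ≠ r₂) (hr₂'min : ∀ w ∈ C₂, w ≠ r₂ → r₂' ≤ w)
    (hlt₁ : r₁ < r₂) (hlt₂ : r₂ < r₁')
    (h₁ : π₁.parts = swapParts π.parts C₁ C₂ {r₁})
    (h₂ : π₂.parts = swapParts π.parts C₁ C₂ {r₂})
    (h₃ : π₃.parts = swapParts π.parts C₁ C₂ {r₁, r₂})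
    (a : GPoint) (hsym : ∀ u v, a.1 (u, v) = a.1 (v, u)) (a₀ : ℝ)
    (hπ : dotP n a (charVec n K π) = a₀)
    (hπ₁ : dotP n a (charVec n K π₁) = a₀)
    (hπ₂ : dotP n a (charVec n K π₂) = a₀)
    (hπ₃ : dotP n a (charVec n K π₃) = a₀) :
    2 * a.1 (r₁, r₂) + repCoef a r₁' + repCoef a r₂' = 2 * repCoef a r₂ := by
  classical
  set rest := π.parts \ {C₁, C₂} with hrest
  have h₀ : π.parts = insert C₁ (insert C₂ rest) := by
    ext C
    simp only [hrest, Finset.mem_insert, Finset.mem_sdiff, Finset.mem_singleton]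
    constructor
    · tauto
    · rintro (rfl | rfl | h)
      exacts [hC₁, hC₂, h.1]
  have hdisj : ∀ u, u ∈ C₁ → u ∉ C₂ := fun u h h' =>
    Finset.disjoint_left.1 (π.parts_disjoint C₁ hC₁ C₂ hC₂ hCne) h h'
  have hrest_disj : ∀ C ∈ rest, ∀ u ∈ C, u ∉ C₁ ∧ u ∉ C₂ := by
    intro C hC u hu
    simp only [hrest, Finset.mem_insert, Finset.mem_sdiff, Finset.mem_singleton, not_or] at hC
    exact ⟨Finset.disjoint_left.1 (π.parts_disjoint C hC.1 C₁ hC₁ hC.2.1) hu,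
      Finset.disjoint_left.1 (π.parts_disjoint C hC.1 C₂ hC₂ hC.2.2) hu⟩
  have hcov : ∀ C ∈ π.parts, ∀ u ∈ C, u ∈ Finset.Icc 1 n := by
    intro C hC u hu
    rw [← π.parts_cover]
    exact Finset.mem_sup.2 ⟨C, hC, hu⟩
  have hr₁C₂ := hdisj r₁ hr₁
  have hr₂C₁ : r₂ ∉ C₁ := fun h => hdisj r₂ h hr₂
  have hr₁'C₂ := hdisj r₁' hr₁'
  have hr₂'C₁ : r₂' ∉ C₁ := fun h => hdisj r₂' h hr₂'
  have hr₂'le := hr₂min r₂' hr₂'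
  unfold swapParts at h₁ h₂ h₃
  rw [← hrest] at h₁ h₂ h₃
  clear_value rest
  have hedge : ∀ u v, u < v →
      (charVec n K π₁).1 (u, v) + (charVec n K π₂).1 (u, v) - (charVec n K π).1 (u, v)
        - (charVec n K π₃).1 (u, v) = if (u, v) = (r₁, r₂) then 2 else 0 := by
    intro u v huv
    rw [charVec_fst_of_parts π h₀, charVec_fst_of_parts π₁ h₁, charVec_fst_of_parts π₂ h₂,
      charVec_fst_of_parts π₃ h₃]
    by_cases hQ : ∃ C ∈ rest, u ∈ C ∧ v ∈ C
    · have hu : u ≠ r₁ := by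
        obtain ⟨C, hC, hu, -⟩ := hQ
        rintro rfl
        exact (hrest_disj C hC _ hu).1 hr₁
      simp [hQ, hu]
    · simp only [hQ, or_false, Finset.mem_union, Finset.mem_sdiff, Finset.mem_inter,
        Finset.mem_insert, Finset.mem_singleton, Prod.mk.injEq]
      have hu := hdisj u
      have hv := hdisj v
      clear * - hu hv huv hr₁ hr₂ hr₁C₂ hr₂C₁ hlt₁
      by_cases hu1 : u = r₁ <;> by_cases hu2 : u = r₂ <;> by_cases hv1 : v = r₁ <;>
        by_cases hv2 : v = r₂ <;> first | (exfalso; omega) | skip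
      all_goals
        by_cases huC : u ∈ C₁ <;> by_cases huD : u ∈ C₂ <;>
          by_cases hvC : v ∈ C₁ <;> by_cases hvD : v ∈ C₂ <;> grind
  have hrep : ∀ v, 4 ≤ v →
      (charVec n K π₁).2 v + (charVec n K π₂).2 v - (charVec n K π).2 v
        - (charVec n K π₃).2 v =
      (if v = r₁' then 1 else 0) + (if v = r₂' then 1 else 0) - 2 * (if v = r₂ then 1 else 0) := by
    intro v hv
    rw [charVec_snd_of_parts π h₀ (m₁ := r₁) (m₂ := r₂) ⟨hr₁, fun w hw => hr₁min w hw⟩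
        ⟨hr₂, fun w hw => hr₂min w hw⟩ hv,
      charVec_snd_of_parts π₁ h₁ (m₁ := r₁') (m₂ := r₁) ?_ ?_ hv,
      charVec_snd_of_parts π₂ h₂ (m₁ := r₁) (m₂ := r₂') ?_ ?_ hv,
      charVec_snd_of_parts π₃ h₃ (m₁ := r₂) (m₂ := r₁) ?_ ?_ hv]
    · by_cases hQ : ∃ C ∈ rest, v ∈ C ∧ ∀ w ∈ C, v ≤ w
      · obtain ⟨C, hC, hvC, -⟩ := id hQ
        obtain ⟨hv1, hv2⟩ := hrest_disj C hC v hvC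
        have e1 : v ≠ r₁' := by rintro rfl; exact hv1 hr₁'
        have e2 : v ≠ r₂' := by rintro rfl; exact hv2 hr₂'
        have e3 : v ≠ r₂ := by rintro rfl; exact hv2 hr₂
        simp [hQ, e1, e2, e3]
      · have e12 : r₁' ≠ r₂' := by rintro rfl; exact hr₁'C₂ hr₂'
        simp only [hQ, or_false]
        clear * - e12 hlt₁ hlt₂ hr₂'le hr₂'ne
        grind
    all_goals
      constructor
      · simp [hr₁, hr₂, hr₁', hr₂', hr₁'ne, hr₂'ne, hr₁C₂, hr₂C₁, hlt₁.ne, hlt₁.ne']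
      · intro w hw
        simp only [Finset.coe_union, Finset.coe_sdiff, Finset.coe_inter, Finset.coe_insert,
          Finset.coe_singleton, Set.mem_union, Set.mem_sdiff, Set.mem_inter_iff,
          Set.mem_insert_iff, Set.mem_singleton_iff, Finset.mem_coe] at hw
        have b1 := hr₁min w
        have b2 := hr₂min w
        have b3 := hr₁'min w
        have b4 := hr₂'min w
        grind
  have hsumE : ∑ e ∈ (Finset.Icc 1 n).offDiag.filter (fun e => e.1 < e.2),
      a.1 e * ((charVec n K π₁).1 e + (charVec n K π₂).1 e - (charVec n K π).1 e
        - (charVec n K π₃).1 e) = 2 * a.1 (r₁, r₂) := by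
    have hmem : (r₁, r₂) ∈ (Finset.Icc 1 n).offDiag.filter (fun e => e.1 < e.2) :=
      Finset.mem_filter.2 ⟨Finset.mem_offDiag.2
        ⟨hcov _ hC₁ _ hr₁, hcov _ hC₂ _ hr₂, hlt₁.ne⟩, hlt₁⟩
    rw [Finset.sum_congr rfl (g := fun e => if e = (r₁, r₂) then 2 * a.1 (r₁, r₂) else 0)]
    · rw [Finset.sum_ite_eq', if_pos hmem]
    · rintro ⟨u, v⟩ he
      rw [hedge u v (Finset.mem_filter.1 he).2]
      split_ifs with h
      · rw [h, mul_comm]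
      · rw [mul_zero]
  have hpick : ∀ r, r ∈ Finset.Icc 1 n →
      ∑ v ∈ Finset.Icc 4 n, a.2 v * (if v = r then 1 else 0) = repCoef a r := by
    intro r hr
    have hle := (Finset.mem_Icc.1 hr).2
    simp [repCoef, hle]
  have hsumV : ∑ v ∈ Finset.Icc 4 n,
      a.2 v * ((charVec n K π₁).2 v + (charVec n K π₂).2 v - (charVec n K π).2 v
        - (charVec n K π₃).2 v) = repCoef a r₁' + repCoef a r₂' - 2 * repCoef a r₂ := by
    rw [← hpick r₁' (hcov _ hC₁ _ hr₁'), ← hpick r₂' (hcov _ hC₂ _ hr₂'),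
      ← hpick r₂ (hcov _ hC₂ _ hr₂), Finset.mul_sum, ← Finset.sum_add_distrib,
      ← Finset.sum_sub_distrib]
    refine Finset.sum_congr rfl fun v hv => ?_
    rw [hrep v (Finset.mem_Icc.1 hv).1]
    ring
  simp only [mul_add, mul_sub, Finset.sum_add_distrib, Finset.sum_sub_distrib] at hsumE hsumV
  unfold dotP at hπ hπ₁ hπ₂ hπ₃
  linarith
end
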